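/- Let E ⊂ ℝⁿ be Hᵐ-measurable with Hᵐ(E) < ∞, and suppose E is NOT m-rectifiable, with Hᵐ⁺¹(closure E) = 0. Then there exists a sequence of Lipschitz maps ψᵢ : ℝⁿ → ℝⁿ converging uniformly to the identity such that liminf Hᵐ(ψᵢ(E)) < Hᵐ(E). -/

import Mathlib

open MeasureTheory Metric Set Filter ENNReal

noncomputable section

abbrev En (n : ℕ) := EuclideanSpace ℝ (Fin n)

/-- A set `E ⊆ ℝⁿ` is `m`-rectifiable if it is covered, up to an `Hᵐ`-null set,
by countably many Lipschitz images of `ℝᵐ`. -/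
def IsRectifiable (n m : ℕ) (E : Set (En n)) : Prop :=
  ∃ f : ℕ → EuclideanSpace ℝ (Fin m) → En n,
    (∀ i, ∃ L : NNReal, LipschitzWith L (f i)) ∧
    μH[m] (E \ ⋃ i, Set.range (f i)) = 0

/-- A set `U` is purely `m`-unrectifiable if `Hᵐ(U ∩ F) = 0` for every `m`-rectifiable `F`. -/
def PurelyUnrectifiable (n m : ℕ) (U : Set (En n)) : Prop :=
  ∀ F : Set (En n), IsRectifiable n m F → μH[m] (U ∩ F) = 0

/-- A measurable set is null if almost every point of each translate of `B` avoids it. -/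
theorem measure_eq_zero_of_forall_ae_add_notMem {G F : Type*} [AddGroup G] [MeasurableSpace G]
    [MeasurableAdd₂ G] [MeasurableSpace F] {μ : Measure G} [SFinite μ] [μ.IsAddRightInvariant]
    {ν : Measure F} [SFinite ν] [NeZero ν] {B : F → G} (hB : Measurable B) {S : Set G}
    (hS : MeasurableSet S) (h : ∀ x, ∀ᵐ y ∂ν, x + B y ∉ S) : μ S = 0 := by
  have hmeas : MeasurableSet {p : G × F | p.1 + B p.2 ∈ S} :=
    hS.preimage (measurable_fst.add (hB.comp measurable_snd))
  have h1 : (μ.prod ν) {p : G × F | p.1 + B p.2 ∈ S} = 0 := by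
    rw [Measure.measure_prod_null hmeas]
    refine Eventually.of_forall fun x => ?_
    have := h x
    rw [ae_iff] at this
    simpa using this
  have h2 : (ν.prod μ) (Prod.swap ⁻¹' {p : G × F | p.1 + B p.2 ∈ S}) = 0 := by
    rw [← Measure.map_apply measurable_swap hmeas, Measure.prod_swap, h1]
  rw [Measure.measure_prod_null (hmeas.preimage measurable_swap)] at h2
  obtain ⟨y, hy⟩ := h2.exists
  have : μ ((fun x => x + B y) ⁻¹' S) = 0 := hy
  rwa [measure_preimage_add_right] at this

/-- Almost every point of almost every translate of `B` avoids a given null set. -/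
theorem ae_ae_add_notMem_of_measure_eq_zero {G F : Type*} [AddGroup G] [MeasurableSpace G]
    [MeasurableAdd₂ G] [MeasurableSpace F] {μ : Measure G} [SFinite μ] [μ.IsAddRightInvariant]
    {ν : Measure F} [SFinite ν] {B : F → G} (hB : Measurable B) {S : Set G}
    (hS : μ S = 0) : ∀ᵐ x ∂μ, ∀ᵐ y ∂ν, x + B y ∉ S := by
  have hmeas : MeasurableSet {p : G × F | p.1 + B p.2 ∈ toMeasurable μ S} :=
    (measurableSet_toMeasurable μ S).preimage (measurable_fst.add (hB.comp measurable_snd))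
  have h2 : (ν.prod μ) (Prod.swap ⁻¹' {p : G × F | p.1 + B p.2 ∈ toMeasurable μ S}) = 0 := by
    rw [Measure.measure_prod_null (hmeas.preimage measurable_swap)]
    refine Eventually.of_forall fun y => ?_
    change μ ((fun x => x + B y) ⁻¹' toMeasurable μ S) = 0
    rw [measure_preimage_add_right, measure_toMeasurable, hS]
  rw [← Measure.map_apply measurable_swap hmeas, Measure.prod_swap,
    Measure.measure_prod_null hmeas] at h2
  filter_upwards [h2] with x hx
  rw [ae_iff]
  refine measure_mono_null (fun y hy => ?_) hx
  exact subset_toMeasurable μ S (by simpa using hy)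

/-- The linear map with columns `L k`. -/
def colMap {N m : ℕ} (L : Fin N → Fin m → ℝ) (x : Fin N → ℝ) : Fin m → ℝ := ∑ k, x k • L k

theorem colMap_sub {N m : ℕ} (L : Fin N → Fin m → ℝ) (x y : Fin N → ℝ) :
    colMap L (x - y) = colMap L x - colMap L y := by
  simp [colMap, sub_smul]

theorem continuous_colMap {N m : ℕ} :
    Continuous fun p : (Fin N → Fin m → ℝ) × (Fin N → ℝ) => colMap p.1 p.2 := by
  unfold colMap; fun_prop

theorem continuous_colMap_right {N m : ℕ} (L : Fin N → Fin m → ℝ) : Continuous (colMap L) := by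
  unfold colMap; fun_prop

theorem lipschitzWith_colMap {N m : ℕ} (L : Fin N → Fin m → ℝ) :
    LipschitzWith (∑ k, ‖L k‖₊) (colMap L) := by
  refine LipschitzWith.of_dist_le_mul fun x y => ?_
  rw [dist_eq_norm, ← colMap_sub, dist_eq_norm, colMap]
  refine (norm_sum_le _ _).trans ?_
  push_cast
  rw [Finset.sum_mul]
  refine Finset.sum_le_sum fun k _ => ?_
  rw [norm_smul, mul_comm]
  gcongr
  exact norm_le_pi_norm (x - y) k

theorem volume_eq_hausdorffMeasure_fin (m : ℕ) :
    (volume : Measure (Fin m → ℝ)) = μH[m] := by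
  have := hausdorffMeasure_pi_real (ι := Fin m)
  simpa using this.symm

theorem volume_closedBall_fin {m : ℕ} (y : Fin m → ℝ) {r : ℝ} (hr : 0 ≤ r) :
    volume (closedBall y r) = ENNReal.ofReal (2 * r) ^ m := by
  rw [Real.volume_pi_closedBall _ hr, Fintype.card_fin, ENNReal.ofReal_pow (by positivity)]

/-- Upper densities of a finite measure are finite almost everywhere. -/
theorem ae_exists_forall_measure_closedBall_le {m : ℕ} (ν : Measure (Fin m → ℝ))
    [IsFiniteMeasure ν] : ∀ᵐ y, ∃ M : ℕ, ∀ r : ℝ, 0 < r →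
      ν (closedBall y r) ≤ M * ENNReal.ofReal r ^ m := by
  filter_upwards [Besicovitch.ae_tendsto_rnDeriv ν (volume : Measure (Fin m → ℝ)),
    ν.rnDeriv_lt_top volume] with y hy hfin
  obtain ⟨A, hA, hA'⟩ := ENNReal.lt_iff_exists_nnreal_btwn.1 hfin
  have h1 : ∀ᶠ r in nhdsWithin (0 : ℝ) (Ioi 0),
      ν (closedBall y r) / volume (closedBall y r) < A := hy.eventually_lt_const hA
  obtain ⟨r₀, hr₀, h2⟩ := mem_nhdsGT_iff_exists_Ioo_subset.1 h1
  have hr₀ : 0 < r₀ := hr₀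
  obtain ⟨M, hM⟩ := ENNReal.exists_nat_gt
    (r := A * 2 ^ m + ν univ / ENNReal.ofReal r₀ ^ m) (by
      refine ENNReal.add_ne_top.2 ⟨ENNReal.mul_ne_top (by simp) (by simp), ?_⟩
      refine ENNReal.div_ne_top (measure_ne_top _ _) ?_
      have := ENNReal.ofReal_pos.2 hr₀
      positivity)
  refine ⟨M, fun r hr => ?_⟩
  have hpos := ENNReal.ofReal_pos.2 hr
  rcases lt_or_ge r r₀ with h | h
  · have h3 := h2 ⟨hr, h⟩
    simp only [mem_ofPred_eq] at h3
    rw [volume_closedBall_fin y hr.le] at h3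
    have h4 := (ENNReal.div_le_iff (by
      have : 0 < ENNReal.ofReal (2 * r) := ENNReal.ofReal_pos.2 (by positivity)
      positivity) (by finiteness)).1 h3.le
    refine h4.trans ?_
    rw [ENNReal.ofReal_mul (by norm_num), mul_pow, ← mul_assoc]
    gcongr
    refine le_trans ?_ hM.le
    simp
  · calc ν (closedBall y r) ≤ ν univ := measure_mono (subset_univ _)
      _ = ν univ / ENNReal.ofReal r₀ ^ m * ENNReal.ofReal r₀ ^ m := by
        rw [ENNReal.div_mul_cancel]
        · have := ENNReal.ofReal_pos.2 hr₀
          positivity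
        · finiteness
      _ ≤ M * ENNReal.ofReal r ^ m := by
        gcongr
        exact le_trans le_add_self hM.le

/-- Almost every fibre of a Lipschitz map on a set of finite Hausdorff measure is finite. -/
theorem volume_setOf_infinite_fiber {X : Type*} [MetricSpace X] [MeasurableSpace X] [BorelSpace X]
    [SecondCountableTopology X] {m : ℕ} {A : Set X} (hA : μH[m] A ≠ ⊤)
    (hAm : MeasurableSet A)
    {f : X → Fin m → ℝ} {C : NNReal} (hf : LipschitzWith C f) :
    volume {y | (A ∩ f ⁻¹' {y}).Infinite} = 0 := by
  rcases isEmpty_or_nonempty X with hX | hX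
  · convert measure_empty (μ := (volume : Measure (Fin m → ℝ)))
    ext y
    simp [Set.eq_empty_of_isEmpty]
  let D : ℕ → ℕ → Set X := fun q => disjointed fun i =>
    ball (TopologicalSpace.denseSeq X i) (1 / (q + 1))
  have hDm : ∀ q i, MeasurableSet (D q i) := fun q i =>
    MeasurableSet.disjointed (fun _ => measurableSet_ball) i
  have hDd : ∀ q, Pairwise (Function.onFun Disjoint (D q)) := fun q => disjoint_disjointed _
  have hDu : ∀ q, ⋃ i, D q i = univ := by
    intro q
    rw [iUnion_disjointed, eq_univ_iff_forall]
    intro x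
    obtain ⟨i, hi⟩ := (TopologicalSpace.denseRange_denseSeq X).exists_dist_lt x
      (ε := 1 / ((q : ℝ) + 1)) (by positivity)
    exact mem_iUnion.2 ⟨i, hi⟩
  let g : ℕ → (Fin m → ℝ) → ℝ≥0∞ := fun q y =>
    ∑' i, (toMeasurable volume (f '' (A ∩ D q i))).indicator 1 y
  have hgm : ∀ q, Measurable (g q) := fun q => Measurable.tsum fun i =>
    measurable_one.indicator (measurableSet_toMeasurable _ _)
  have hg : ∀ q, ∫⁻ y, g q y ≤ (C : ℝ≥0∞) ^ m * μH[m] A := by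
    intro q
    rw [lintegral_tsum fun i =>
      (measurable_one.indicator (measurableSet_toMeasurable _ _)).aemeasurable]
    calc ∑' i, ∫⁻ y, (toMeasurable volume (f '' (A ∩ D q i))).indicator 1 y
        = ∑' i, volume (f '' (A ∩ D q i)) := by
          congr 1; ext i
          rw [lintegral_indicator_one (measurableSet_toMeasurable _ _), measure_toMeasurable]
      _ ≤ ∑' i, (C : ℝ≥0∞) ^ m * μH[m] (A ∩ D q i) := by
          refine ENNReal.tsum_le_tsum fun i => ?_
          rw [volume_eq_hausdorffMeasure_fin]
          simpa using hf.hausdorffMeasure_image_le (d := m) (by positivity) (A ∩ D q i)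
      _ = (C : ℝ≥0∞) ^ m * μH[m] A := by
          rw [ENNReal.tsum_mul_left, ← measure_iUnion, ← inter_iUnion, hDu, inter_univ]
          · intro i j hij
            exact ((hDd q hij).mono inter_subset_right inter_subset_right)
          · exact fun i => hAm.inter (hDm q i)
  have hlim : ∫⁻ y, liminf (fun q => g q y) atTop ≠ ⊤ := by
    refine ne_top_of_le_ne_top (b := (C : ℝ≥0∞) ^ m * μH[m] A) (by finiteness) ?_
    refine (lintegral_liminf_le hgm).trans ?_
    exact liminf_le_of_le (by isBoundedDefault) fun b hb => by
      obtain ⟨q, hq⟩ := hb.exists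
      exact hq.trans (hg q)
  have hae := ae_lt_top (Measurable.liminf hgm) hlim
  refine measure_mono_null (fun y hy => ?_) hae
  simp only [mem_compl_iff, mem_ofPred_eq, not_lt, top_le_iff] at hy ⊢
  refine ENNReal.eq_top_of_forall_nnreal_le fun M => ?_
  obtain ⟨T, hT, hTc⟩ := hy.exists_subset_card_eq ⌈M⌉₊
  have hsep : ∃ δ > 0, ∀ x ∈ T, ∀ x' ∈ T, x ≠ x' → δ ≤ dist x x' := by
    have hfin : (T : Set X).Finite := T.finite_toSet
    rcases Set.subsingleton_or_nontrivial (T : Set X) with hs | hs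
    · exact ⟨1, one_pos, fun x hx x' hx' hne => (hne (hs hx hx')).elim⟩
    · refine ⟨(T : Set X).infsep, hfin.infsep_pos_iff_nontrivial.2 hs, fun x hx x' hx' hne => ?_⟩
      exact Set.infsep_le_dist_of_mem hx hx' hne
  obtain ⟨δ, hδ, hsep⟩ := hsep
  refine le_liminf_of_le (by isBoundedDefault) ?_
  have hev : ∀ᶠ q : ℕ in atTop, 2 * (1 / ((q : ℝ) + 1)) < δ := by
    have := (tendsto_one_div_add_atTop_nhds_zero_nat (𝕜 := ℝ)).const_mul 2
    rw [mul_zero] at this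
    exact this.eventually_lt_const hδ
  filter_upwards [hev] with q hq
  have hcell : ∀ x, ∃ i, x ∈ D q i := fun x => mem_iUnion.1 (by rw [hDu]; trivial)
  choose ci hci using hcell
  have hinj : Set.InjOn ci T := by
    intro x hx x' hx' h
    by_contra hne
    have h1 := disjointed_subset _ _ (hci x)
    have h2 := disjointed_subset _ _ (hci x')
    rw [h] at h1
    rw [mem_ball] at h1 h2
    have := dist_triangle_right x x' (TopologicalSpace.denseSeq X (ci x'))
    linarith [hsep x hx x' hx' hne]
  calc (M : ℝ≥0∞) ≤ (T.image ci).card := by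
        rw [Finset.card_image_of_injOn hinj, hTc]
        exact_mod_cast Nat.le_ceil M
    _ = ∑ i ∈ T.image ci, (1 : ℝ≥0∞) := by simp
    _ ≤ ∑ i ∈ T.image ci, (toMeasurable volume (f '' (A ∩ D q i))).indicator 1 y := by
        refine Finset.sum_le_sum fun i hi => ?_
        obtain ⟨x, hx, rfl⟩ := Finset.mem_image.1 hi
        rw [indicator_of_mem]
        · rfl
        · refine subset_toMeasurable _ _ ⟨x, ⟨(hT hx).1, hci x⟩, (hT hx).2⟩
    _ ≤ g q y := ENNReal.sum_le_tsum _

/-- `A` contains no subset of positive `Hᵐ` measure parametrized by a Lipschitz map from a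
subset of `ℝᵐ`. -/
def NoLipschitzPiece {X : Type*} [MetricSpace X] [MeasurableSpace X] [BorelSpace X] (m : ℕ)
    (A : Set X) : Prop :=
  ∀ (S : Set (Fin m → ℝ)) (f : (Fin m → ℝ) → X) (C : NNReal), LipschitzOnWith C f S →
    f '' S ⊆ A → μH[m] (f '' S) = 0

/-- The part of the `r`-ball around `a` lying in the cone of aperture `s` around the `j`-th axis and
the fibre of `colMap L`. -/
def coordCone {N m : ℕ} (L : Fin N → Fin m → ℝ) (j : Fin N) (a : Fin N → ℝ) (r s : ℝ) :
    Set (Fin N → ℝ) :=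
  {x | dist x a ≤ r ∧ x j ≠ a j ∧ ‖colMap L (x - a)‖ ≤ s * |x j - a j|}

theorem measurableSet_setOf_mem_coordCone {N m : ℕ} (j : Fin N) (r s : ℝ) :
    MeasurableSet {p : ((Fin N → ℝ) × (Fin N → Fin m → ℝ)) × (Fin N → ℝ) |
      p.2 ∈ coordCone p.1.2 j p.1.1 r s} := by
  have h1 : IsClosed {p : ((Fin N → ℝ) × (Fin N → Fin m → ℝ)) × (Fin N → ℝ) |
      dist p.2 p.1.1 ≤ r} := isClosed_le (by fun_prop) (by fun_prop)
  have h2 : IsOpen {p : ((Fin N → ℝ) × (Fin N → Fin m → ℝ)) × (Fin N → ℝ) |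
      p.2 j ≠ p.1.1 j} := isOpen_ne_fun (by fun_prop) (by fun_prop)
  have h3 : IsClosed {p : ((Fin N → ℝ) × (Fin N → Fin m → ℝ)) × (Fin N → ℝ) |
      ‖colMap p.1.2 (p.2 - p.1.1)‖ ≤ s * |p.2 j - p.1.1 j|} := by
    refine isClosed_le ?_ (by fun_prop)
    exact (continuous_colMap.comp (f := fun p : ((Fin N → ℝ) × (Fin N → Fin m → ℝ)) ×
      (Fin N → ℝ) => (p.1.2, p.2 - p.1.1)) (by fun_prop)).norm
  exact h1.measurableSet.inter (h2.measurableSet.inter h3.measurableSet)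

theorem measurableSet_coordCone {N m : ℕ} (L : Fin N → Fin m → ℝ) (j : Fin N) (a : Fin N → ℝ)
    (r s : ℝ) : MeasurableSet (coordCone L j a r s) :=
  (measurableSet_setOf_mem_coordCone (m := m) j r s).preimage (measurable_prodMk_left (x := (a, L)))

theorem exists_mem_coordCone {N m : ℕ} (L : Fin N → Fin m → ℝ) {a x : Fin N → ℝ} {r s : ℝ}
    (hxa : 0 < dist x a) (hr : dist x a ≤ r) (h : ‖colMap L (x - a)‖ ≤ s * dist x a) :
    ∃ j, x ∈ coordCone L j a r s := by
  have hne : Nonempty (Fin N) := by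
    by_contra hN
    rw [not_nonempty_iff] at hN
    rw [Subsingleton.elim x a, dist_self] at hxa
    exact lt_irrefl _ hxa
  obtain ⟨j, hj⟩ := Finite.exists_max fun k => dist (x k) (a k)
  have hd : dist x a = dist (x j) (a j) :=
    le_antisymm ((dist_pi_le_iff dist_nonneg).2 hj) (dist_le_pi_dist x a j)
  refine ⟨j, hr, ?_, ?_⟩
  · intro h0
    rw [hd, h0, dist_self] at hxa
    exact lt_irrefl _ hxa
  · rwa [← Real.dist_eq, ← hd]

/-- Vitali covering estimate. -/
theorem measure_le_mul_volume_of_closedBall {Z : Type*} [MeasurableSpace Z] {m : ℕ}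
    (ν : Measure Z) (p : Z → Fin m → ℝ) (W : Set Z) (O : Set (Fin m → ℝ)) (r : Z → ℝ) {R : ℝ}
    (κ : ℝ≥0∞) (hr : ∀ z ∈ W, 0 < r z) (hR : ∀ z ∈ W, r z ≤ R)
    (hO : ∀ z ∈ W, closedBall (p z) (r z) ⊆ O)
    (hν : ∀ z ∈ W, ν (W ∩ p ⁻¹' closedBall (p z) (5 * r z)) ≤ κ * ENNReal.ofReal (r z) ^ m) :
    ν W ≤ κ * volume O := by
  obtain ⟨u, huW, hdisj, hcov⟩ := Vitali.exists_disjoint_subfamily_covering_enlargement_closedBall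
    W p r R hR 5 (by norm_num)
  have hcount : u.Countable := by
    refine hdisj.countable_of_nonempty_interior fun z hz => ?_
    exact ⟨p z, ball_subset_interior_closedBall (mem_ball_self (hr z (huW hz)))⟩
  have := hcount.to_subtype
  calc ν W ≤ ν (⋃ z ∈ u, W ∩ p ⁻¹' closedBall (p z) (5 * r z)) := by
        refine measure_mono fun z hz => ?_
        obtain ⟨b, hb, hsub⟩ := hcov z hz
        exact mem_biUnion hb ⟨hz, hsub (mem_closedBall_self (hr z hz).le)⟩
    _ ≤ ∑' z : u, ν (W ∩ p ⁻¹' closedBall (p z) (5 * r z)) := measure_biUnion_le _ hcount _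
    _ ≤ ∑' z : u, κ * volume (closedBall (p z) (r z)) := by
        refine ENNReal.tsum_le_tsum fun z => (hν z (huW z.2)).trans ?_
        rw [volume_closedBall_fin _ (hr z (huW z.2)).le]
        gcongr
        linarith [hr z (huW z.2)]
    _ = κ * volume (⋃ z ∈ u, closedBall (p z) (r z)) := by
        rw [ENNReal.tsum_mul_left,
          measure_biUnion hcount hdisj fun z _ => measurableSet_closedBall]
    _ ≤ κ * volume O := by
        gcongr
        exact iUnion₂_subset fun z hz => hO z (huW hz)

theorem exists_pow_half_between {d : ℝ} (hd : 0 < d) (p : ℕ) (hp : d ≤ (1 / 2) ^ p) :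
    ∃ i, p ≤ i ∧ d ≤ (1 / 2 : ℝ) ^ i ∧ (1 / 2 : ℝ) ^ i < 2 * d := by
  have hd1 : d ≤ 1 := hp.trans (pow_le_one₀ (by norm_num) (by norm_num))
  obtain ⟨i, hi1, hi2⟩ := exists_nat_pow_near_of_lt_one hd hd1 (y := (1 / 2 : ℝ)) (by norm_num)
    (by norm_num)
  refine ⟨i, ?_, hi2, ?_⟩
  · by_contra hlt
    push Not at hlt
    have : (1 / 2 : ℝ) ^ p ≤ (1 / 2) ^ (i + 1) :=
      pow_le_pow_of_le_one (by norm_num) (by norm_num) hlt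
    linarith
  · rw [pow_succ] at hi1
    linarith

/-- Quantitative smallness of the cone-sparse part. -/
theorem hausdorffMeasure_le_of_coordCone_le {N m : ℕ} {A B : Set (Fin N → ℝ)}
    (hA : NoLipschitzPiece m A) (L : Fin N → Fin m → ℝ) (hBA : B ⊆ A) {p l : ℕ} {ε : ℝ≥0∞}
    (hdiam : ∀ x ∈ B, ∀ y ∈ B, dist x y ≤ (1 / 2) ^ (p + 1))
    {O : Set (Fin m → ℝ)} (hO : ∀ a ∈ B, closedBall (colMap L a) 1 ⊆ O)
    (hcone : ∀ a ∈ B, ∀ i, p ≤ i → ∀ j,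
      μH[m].restrict A (coordCone L j a ((1 / 2) ^ i) ((1 / 2) ^ l)) ≤
        ε * ENNReal.ofReal ((1 / 2) ^ i * (1 / 2) ^ l) ^ m) :
    μH[m] B ≤ (2 * N * ENNReal.ofReal 80 ^ m * volume O) * ε := by
  set s : ℝ := (1 / 2) ^ l with hs
  have hs0 : 0 < s := by positivity
  have hs1 : s ≤ 1 := pow_le_one₀ (by norm_num) (by norm_num)
  let B₀ : Set (Fin N → ℝ) := {a ∈ B | ∀ b ∈ B, b ≠ a → s / 8 * dist b a < ‖colMap L (b - a)‖}
  have hB₀ : μH[m] B₀ = 0 := by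
    have hanti : ∀ a ∈ B₀, ∀ b ∈ B₀, dist a b ≤ 8 / s * dist (colMap L a) (colMap L b) := by
      intro a ha b hb
      rcases eq_or_ne a b with rfl | hne
      · simp
      · have := hb.2 a ha.1 hne
        rw [colMap_sub, ← dist_eq_norm] at this
        rw [div_mul_eq_mul_div, le_div_iff₀ hs0]
        linarith
    have hinj : InjOn (colMap L) B₀ := by
      intro a ha b hb h
      have := hanti a ha b hb
      rw [h, dist_self, mul_zero] at this
      exact dist_le_zero.1 this
    rcases B₀.eq_empty_or_nonempty with h0 | ⟨x₀, hx₀⟩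
    · rw [h0]; simp
    have hne : Nonempty (Fin N → ℝ) := ⟨x₀⟩
    have himage : Function.invFunOn (colMap L) B₀ '' (colMap L '' B₀) = B₀ :=
      hinj.leftInvOn_invFunOn.image_image
    have := hA (colMap L '' B₀) (Function.invFunOn (colMap L) B₀) (Real.toNNReal (8 / s)) ?_ ?_
    · rwa [himage] at this
    · refine LipschitzOnWith.of_dist_le_mul ?_
      rintro _ ⟨a, ha, rfl⟩ _ ⟨b, hb, rfl⟩
      rw [hinj.leftInvOn_invFunOn ha, hinj.leftInvOn_invFunOn hb,
        Real.coe_toNNReal _ (by positivity)]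
      exact hanti a ha b hb
    · rw [himage]; exact fun a ha => hBA ha.1
  have hfar : ∀ a ∈ B \ B₀, ∃ b ∈ B, 0 < dist b a ∧ ‖colMap L (b - a)‖ ≤ s / 8 * dist b a ∧
      ∀ x ∈ B, ‖colMap L (x - a)‖ ≤ s / 8 * dist x a → dist x a ≤ 2 * dist b a := by
    intro a ha
    have hex : ∃ b ∈ B, b ≠ a ∧ ‖colMap L (b - a)‖ ≤ s / 8 * dist b a := by
      by_contra hcon
      push Not at hcon
      exact ha.2 ⟨ha.1, hcon⟩
    obtain ⟨b₀, hb₀, hne, hb₀'⟩ := hex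
    let T : Set ℝ := (fun b => dist b a) '' {b ∈ B | ‖colMap L (b - a)‖ ≤ s / 8 * dist b a}
    have hTb : BddAbove T := ⟨(1 / 2) ^ (p + 1), by
      rintro _ ⟨b, hb, rfl⟩
      exact hdiam b hb.1 a ha.1⟩
    have hTn : T.Nonempty := ⟨_, b₀, ⟨hb₀, hb₀'⟩, rfl⟩
    have hpos : 0 < sSup T :=
      lt_of_lt_of_le (dist_pos.2 hne) (le_csSup hTb ⟨b₀, ⟨hb₀, hb₀'⟩, rfl⟩)
    obtain ⟨_, ⟨b, hb, rfl⟩, hlt⟩ := exists_lt_of_lt_csSup hTn (half_lt_self hpos)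
    refine ⟨b, hb.1, (half_pos hpos).trans hlt, hb.2, fun x hx hx' => ?_⟩
    have := le_csSup hTb ⟨x, ⟨hx, hx'⟩, rfl⟩
    simp only at hlt this
    linarith
  choose! b hbB hbpos hbcone hbmax using hfar
  have hmain : μH[m] (B \ B₀) ≤ (2 * N * ENNReal.ofReal 80 ^ m * ε) * volume O := by
    refine measure_le_mul_volume_of_closedBall μH[m] (colMap L) (B \ B₀) O
      (fun a => s * dist (b a) a / 20) (R := 1) _ ?_ ?_ ?_ ?_
    · intro a ha
      have := hbpos a ha
      positivity
    · intro a ha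
      have h1 : dist (b a) a ≤ 1 := (hdiam _ (hbB a ha) _ ha.1).trans
        (pow_le_one₀ (by norm_num) (by norm_num))
      have := hbpos a ha
      have : s * dist (b a) a ≤ 1 := mul_le_one₀ hs1 this.le h1
      linarith
    · intro a ha
      refine Subset.trans (closedBall_subset_closedBall ?_) (hO a ha.1)
      have h1 : dist (b a) a ≤ 1 := (hdiam _ (hbB a ha) _ ha.1).trans
        (pow_le_one₀ (by norm_num) (by norm_num))
      have := hbpos a ha
      have : s * dist (b a) a ≤ 1 := mul_le_one₀ hs1 this.le h1
      linarith
    · intro a ha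
      set d := dist (b a) a with hd
      have hd0 : 0 < d := hbpos a ha
      obtain ⟨i, hpi, hi1, hi2⟩ := exists_pow_half_between (d := 2 * d) (by positivity) p (by
        have := hdiam _ (hbB a ha) _ ha.1
        rw [pow_succ] at this
        linarith)
      have hsub : (B \ B₀) ∩ colMap L ⁻¹' closedBall (colMap L a) (5 * (s * d / 20)) ⊆
          (⋃ j, coordCone L j a ((1 / 2) ^ i) s ∩ A) ∪
            ⋃ j, coordCone L j (b a) ((1 / 2) ^ i) s ∩ A := by
        rintro x ⟨hxB, hx⟩
        rw [mem_preimage, mem_closedBall, dist_eq_norm, ← colMap_sub] at hx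
        have hsd : 0 < s * d := by positivity
        have hxa : dist x a ≤ 2 * d := by
          by_contra hlt
          push Not at hlt
          refine absurd (hbmax a ha x hxB.1 ?_) (not_le.2 hlt)
          nlinarith
        rcases le_or_gt (d / 2) (dist x a) with hcase | hcase
        · obtain ⟨j, hj⟩ := exists_mem_coordCone L (s := s) (by linarith) (hxa.trans hi1)
            (hx.trans (by nlinarith))
          exact Or.inl (mem_iUnion.2 ⟨j, hj, hBA hxB.1⟩)
        · have h1 : d / 2 ≤ dist x (b a) := by
            have := dist_triangle_left (b a) a x
            linarith
          have h2 : dist x (b a) ≤ 2 * d := by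
            have := dist_triangle_right x (b a) a
            linarith
          have h3 : ‖colMap L (x - b a)‖ ≤ s * dist x (b a) := by
            have e : x - b a = (x - a) - (b a - a) := by abel
            rw [e, colMap_sub]
            refine (norm_sub_le _ _).trans ?_
            have := hbcone a ha
            nlinarith
          obtain ⟨j, hj⟩ := exists_mem_coordCone L (s := s) (by linarith) (h2.trans hi1) h3
          exact Or.inr (mem_iUnion.2 ⟨j, hj, hBA hxB.1⟩)
      have hbound : ∀ c ∈ B, μH[m] (⋃ j, coordCone L j c ((1 / 2) ^ i) s ∩ A) ≤
          N * (ε * ENNReal.ofReal (4 * d * s) ^ m) := by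
        intro c hc
        refine (measure_iUnion_fintype_le _ _).trans ?_
        calc ∑ j, μH[m] (coordCone L j c ((1 / 2) ^ i) s ∩ A)
            ≤ ∑ j : Fin N, ε * ENNReal.ofReal (4 * d * s) ^ m := by
              refine Finset.sum_le_sum fun j _ => ?_
              rw [← Measure.restrict_apply (measurableSet_coordCone _ _ _ _ _)]
              refine (hcone c hc i hpi j).trans ?_
              gcongr
              linarith
          _ = _ := by simp
      calc μH[m] ((B \ B₀) ∩ colMap L ⁻¹' closedBall (colMap L a) (5 * (s * d / 20)))
          ≤ N * (ε * ENNReal.ofReal (4 * d * s) ^ m) + N * (ε * ENNReal.ofReal (4 * d * s) ^ m) :=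
            (measure_mono hsub).trans ((measure_union_le _ _).trans
              (add_le_add (hbound a ha.1) (hbound _ (hbB a ha))))
        _ = 2 * N * ENNReal.ofReal 80 ^ m * ε * ENNReal.ofReal (s * d / 20) ^ m := by
            have : 4 * d * s = 80 * (s * d / 20) := by ring
            rw [this, ENNReal.ofReal_mul (by norm_num), mul_pow]
            ring
  calc μH[m] B ≤ μH[m] (B₀ ∪ B \ B₀) := measure_mono (by
        intro x hx
        by_cases h : x ∈ B₀
        · exact Or.inl h
        · exact Or.inr ⟨hx, h⟩)
    _ ≤ μH[m] B₀ + μH[m] (B \ B₀) := measure_union_le _ _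
    _ ≤ _ := by
        rw [hB₀, zero_add]
        refine hmain.trans (le_of_eq ?_)
        ring

/-- The points of `A` at which all coordinate cones have vanishing density form a null set. -/
theorem hausdorffMeasure_setOf_coordCone_density_zero {N m : ℕ} {A : Set (Fin N → ℝ)}
    (hA : NoLipschitzPiece m A) (hAc : IsCompact A) (L : Fin N → Fin m → ℝ) (p : ℕ) :
    μH[m] {a ∈ A | ∀ j, ∀ k : ℕ, ∃ l₀, ∀ l ≥ l₀, ∀ i ≥ p,
      μH[m].restrict A (coordCone L j a ((1 / 2) ^ i) ((1 / 2) ^ l)) ≤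
        (k + 1 : ℝ≥0∞)⁻¹ * ENNReal.ofReal ((1 / 2) ^ i * (1 / 2) ^ l) ^ m} = 0 := by
  set D := {a ∈ A | ∀ j, ∀ k : ℕ, ∃ l₀, ∀ l ≥ l₀, ∀ i ≥ p,
      μH[m].restrict A (coordCone L j a ((1 / 2) ^ i) ((1 / 2) ^ l)) ≤
        (k + 1 : ℝ≥0∞)⁻¹ * ENNReal.ofReal ((1 / 2) ^ i * (1 / 2) ^ l) ^ m} with hD
  -- cover by finitely many small balls
  have hloc : ∀ c : Fin N → ℝ, μH[m] (D ∩ closedBall c ((1 / 2) ^ (p + 2))) = 0 := by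
    intro c
    set O : Set (Fin m → ℝ) := cthickening 1 (colMap L '' A) with hO
    have hOfin : volume O ≠ ⊤ :=
      ((hAc.image (continuous_colMap_right L)).cthickening).measure_ne_top
    set Q : ℝ≥0∞ := 2 * N * ENNReal.ofReal 80 ^ m * volume O with hQ
    have hQfin : Q ≠ ⊤ := by finiteness
    have hk : ∀ k : ℕ, μH[m] (D ∩ closedBall c ((1 / 2) ^ (p + 2))) ≤ Q * (k + 1 : ℝ≥0∞)⁻¹ := by
      intro k
      let B : ℕ → Set (Fin N → ℝ) := fun l₀ => {a ∈ A ∩ closedBall c ((1 / 2) ^ (p + 2)) |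
        ∀ j, ∀ l ≥ l₀, ∀ i ≥ p,
        μH[m].restrict A (coordCone L j a ((1 / 2) ^ i) ((1 / 2) ^ l)) ≤
        (k + 1 : ℝ≥0∞)⁻¹ * ENNReal.ofReal ((1 / 2) ^ i * (1 / 2) ^ l) ^ m}
      have hBmono : Monotone B := fun l₀ l₁ h a ha =>
        ⟨ha.1, fun j l hl => ha.2 j l (h.trans hl)⟩
      have hsub : D ∩ closedBall c ((1 / 2) ^ (p + 2)) ⊆ ⋃ l₀, B l₀ := by
        rintro a ⟨ha, hac⟩
        have h1 : ∀ j, ∃ l₀, ∀ l ≥ l₀, ∀ i ≥ p,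
          μH[m].restrict A (coordCone L j a ((1 / 2) ^ i) ((1 / 2) ^ l)) ≤
          (k + 1 : ℝ≥0∞)⁻¹ * ENNReal.ofReal ((1 / 2) ^ i * (1 / 2) ^ l) ^ m := fun j => ha.2 j k
        choose l₀ hl₀ using h1
        refine mem_iUnion.2 ⟨Finset.univ.sup l₀, ⟨ha.1, hac⟩, fun j l hl => ?_⟩
        exact hl₀ j l ((Finset.le_sup (Finset.mem_univ j)).trans hl)
      refine (measure_mono hsub).trans ?_
      rw [hBmono.measure_iUnion]
      refine iSup_le fun l₀ => ?_
      refine hausdorffMeasure_le_of_coordCone_le hA L (fun a ha => ha.1.1) (p := p) (l := l₀)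
        ?_ ?_ ?_
      · intro x hx y hy
        have h1 := mem_closedBall.1 hx.1.2
        have h2 := mem_closedBall.1 hy.1.2
        have h3 := dist_triangle_right x y c
        have h4 : (1 / 2 : ℝ) ^ (p + 1) = 2 * (1 / 2) ^ (p + 2) := by ring
        linarith
      · intro a ha
        exact closedBall_subset_cthickening (mem_image_of_mem _ ha.1.1) 1
      · intro a ha i hi j
        exact ha.2 j l₀ le_rfl i hi
    have hlim : Tendsto (fun k : ℕ => Q * (k + 1 : ℝ≥0∞)⁻¹) atTop (nhds (Q * 0)) := by
      refine ENNReal.Tendsto.const_mul ?_ (Or.inr hQfin)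
      have := (tendsto_add_atTop_iff_nat 1).2 ENNReal.tendsto_inv_nat_nhds_zero
      simpa using this
    rw [mul_zero] at hlim
    exact le_antisymm (ge_of_tendsto' hlim hk) bot_le
  obtain ⟨T, -, hTf, hT⟩ := hAc.finite_cover_balls (e := (1 / 2) ^ (p + 2)) (by positivity)
  refine measure_mono_null (t := ⋃ c ∈ T, D ∩ closedBall c ((1 / 2) ^ (p + 2))) ?_
    ((measure_biUnion_null_iff hTf.countable).2 fun c _ => hloc c)
  intro a ha
  obtain ⟨c, hc, hac⟩ := mem_iUnion₂.1 (hT ha.1)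
  exact mem_biUnion hc ⟨ha, ball_subset_closedBall hac⟩

/-- Zero-infinity dichotomy for the upper density, off `Θ`, of a sequence of measures carried by
`Θ`. -/
theorem ae_density_zero_of_bounded {m : ℕ} (ν : ℕ → Measure (Fin m → ℝ)) {Θ : Set (Fin m → ℝ)}
    (hΘ : MeasurableSet Θ) (hν : ∀ i, ν i Θᶜ = 0) :
    ∀ᵐ t, t ∉ Θ → ∀ M : ℕ,
      (∀ i l, ν i (closedBall t ((1 / 2) ^ l)) ≤ M * ENNReal.ofReal ((1 / 2) ^ l) ^ m) →
      ∀ k : ℕ, ∃ l₀, ∀ l ≥ l₀, ∀ i,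
        ν i (closedBall t ((1 / 2) ^ l)) ≤ (k + 1 : ℝ≥0∞)⁻¹ * ENNReal.ofReal ((1 / 2) ^ l) ^ m := by
  let C : ℕ → Set (Fin m → ℝ) := fun M =>
    {t | ∀ i l, ν i (closedBall t ((1 / 2) ^ l)) ≤ M * ENNReal.ofReal ((1 / 2) ^ l) ^ m}
  have hball : ∀ M, ∀ u ∈ C M, ∀ r, 0 < r → r ≤ 1 → ∀ i,
      ν i (closedBall u r) ≤ M * ENNReal.ofReal (2 * r) ^ m := by
    intro M u hu r hr hr1 i
    obtain ⟨l, -, h1, h2⟩ := exists_pow_half_between hr 0 (by simpa using hr1)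
    refine (measure_mono (closedBall_subset_closedBall h1)).trans ((hu i l).trans ?_)
    gcongr
  have hdens : ∀ᵐ t, ∀ M, Tendsto (fun r => volume ((closure (C M) \ Θ)ᶜ ∩ closedBall t r) /
      volume (closedBall t r)) (nhdsWithin 0 (Ioi 0))
      (nhds ((closure (C M) \ Θ)ᶜ.indicator 1 t)) := by
    rw [ae_all_iff]
    intro M
    exact Besicovitch.ae_tendsto_measure_inter_div_of_measurableSet volume
      (isClosed_closure.measurableSet.diff hΘ).compl
  filter_upwards [hdens] with t ht htΘ M htM k
  replace ht := ht M
  have htC : t ∈ closure (C M) := subset_closure htM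
  rw [indicator_of_notMem (by simp [htC, htΘ])] at ht
  set η : ℝ≥0∞ := (k + 1 : ℝ≥0∞)⁻¹ / (M * ENNReal.ofReal 16 ^ m + 1) / 4 ^ m with hη
  have hη0 : 0 < η := by
    have h1 : (k + 1 : ℝ≥0∞)⁻¹ ≠ 0 := ENNReal.inv_ne_zero.2 (by finiteness)
    refine ENNReal.div_pos (ENNReal.div_pos h1 (by finiteness)).ne' (by finiteness)
  have hev := ht.eventually_lt_const hη0
  obtain ⟨r₀, hr₀, hr₀'⟩ := mem_nhdsGT_iff_exists_Ioo_subset.1 hev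
  have hr₀ : 0 < r₀ := hr₀
  obtain ⟨l₁, hl₁⟩ := exists_pow_lt_of_lt_one (half_pos hr₀) (by norm_num : (1 / 2 : ℝ) < 1)
  refine ⟨max l₁ 3, fun l hl i => ?_⟩
  set s : ℝ := (1 / 2) ^ l with hs
  have hs0 : 0 < s := by positivity
  have hs8 : 8 * s ≤ 1 := by
    have : s ≤ (1 / 2) ^ 3 := pow_le_pow_of_le_one (by norm_num) (by norm_num)
      ((le_max_right _ _).trans hl)
    linarith
  have hsr : 2 * s < r₀ := by
    have : s ≤ (1 / 2) ^ l₁ := pow_le_pow_of_le_one (by norm_num) (by norm_num)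
      ((le_max_left _ _).trans hl)
    linarith
  have hvol : volume ((closure (C M) \ Θ)ᶜ ∩ closedBall t (2 * s)) <
      η * ENNReal.ofReal (2 * (2 * s)) ^ m := by
    have h1 : volume ((closure (C M) \ Θ)ᶜ ∩ closedBall t (2 * s)) /
      volume (closedBall t (2 * s)) < η := hr₀' ⟨by linarith, hsr⟩
    rw [volume_closedBall_fin t (by positivity)] at h1
    have hpos : 0 < ENNReal.ofReal (2 * (2 * s)) := ENNReal.ofReal_pos.2 (by positivity)
    rwa [ENNReal.div_lt_iff (Or.inl (by positivity)) (Or.inl (by finiteness))] at h1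
  obtain ⟨O, hOsub, hOo, hOvol⟩ := Set.exists_isOpen_lt_of_lt _ _ hvol
  have hrad : ∀ u ∈ closedBall t s \ (closure (C M) \ Θ), ∃ r, 0 < r ∧ r ≤ s ∧
      closedBall u r ⊆ O ∧ ∃ u' ∈ C M, dist u u' < 3 * r := by
    rintro u ⟨hut, hu⟩
    by_cases huC : u ∈ closure (C M)
    · have huO : u ∈ O := hOsub ⟨hu, closedBall_subset_closedBall (by linarith) hut⟩
      obtain ⟨r, hr, hrO⟩ := Metric.nhds_basis_closedBall.mem_iff.1 (hOo.mem_nhds huO)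
      have hr' : 0 < min r s := lt_min hr hs0
      refine ⟨min r s, hr', min_le_right _ _,
        (closedBall_subset_closedBall (min_le_left _ _)).trans hrO, ?_⟩
      obtain ⟨u', hu', h⟩ := Metric.mem_closure_iff.1 huC (3 * min r s) (by positivity)
      exact ⟨u', hu', h⟩
    · have hne : (C M).Nonempty := ⟨t, htM⟩
      have hd : 0 < infDist u (C M) := by
        rw [← infDist_closure]
        exact (isClosed_closure.notMem_iff_infDist_pos hne.closure).1 huC
      have hd' : infDist u (C M) ≤ s := (infDist_le_dist_of_mem (show t ∈ C M from htM)).trans hut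
      refine ⟨infDist u (C M) / 2, by positivity, by linarith, ?_, ?_⟩
      · intro v hv
        refine hOsub ⟨fun hv' => ?_, ?_⟩
        · have h1 : infDist u (closure (C M)) ≤ dist u v := infDist_le_dist_of_mem hv'.1
          rw [infDist_closure] at h1
          rw [mem_closedBall, dist_comm] at hv
          linarith
        · rw [mem_closedBall] at hv hut ⊢
          have := dist_triangle v u t
          linarith
      · obtain ⟨u', hu', h⟩ := (infDist_lt_iff (x := u) hne).1
          (show infDist u (C M) < 3 * (infDist u (C M) / 2) by linarith)
        exact ⟨u', hu', h⟩
  choose! r hr0 hrs hrO hru using hrad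
  have hW : ν i (closedBall t s \ (closure (C M) \ Θ)) ≤
      (M * ENNReal.ofReal 16 ^ m) * volume O := by
    refine measure_le_mul_volume_of_closedBall (ν i) id _ O r _ hr0 hrs hrO ?_
    intro u hu
    obtain ⟨u', hu', hd⟩ := hru u hu
    have h1 := hr0 u hu
    have h2 := hrs u hu
    calc _ ≤ ν i (closedBall u' (8 * r u)) := by
          refine measure_mono fun v hv => ?_
          have hv2 : dist v u ≤ 5 * r u := hv.2
          rw [mem_closedBall]
          have := dist_triangle v u u'
          linarith
      _ ≤ M * ENNReal.ofReal (2 * (8 * r u)) ^ m :=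
          hball M u' hu' _ (by positivity) (by linarith) i
      _ = _ := by
          rw [show 2 * (8 * r u) = 16 * r u by ring, ENNReal.ofReal_mul (by norm_num), mul_pow]
          ring
  have hzero : ν i (closure (C M) \ Θ) = 0 := measure_mono_null (fun x hx => hx.2) (hν i)
  have hpos1 : (M * ENNReal.ofReal 16 ^ m + 1 : ℝ≥0∞) ≠ 0 := by positivity
  have hfin1 : (M * ENNReal.ofReal 16 ^ m + 1 : ℝ≥0∞) ≠ ⊤ := by finiteness
  calc ν i (closedBall t s)
      ≤ ν i ((closedBall t s \ (closure (C M) \ Θ)) ∪ (closure (C M) \ Θ)) :=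
        measure_mono (by rw [sdiff_union_self]; exact subset_union_left)
    _ ≤ ν i (closedBall t s \ (closure (C M) \ Θ)) + ν i (closure (C M) \ Θ) := measure_union_le _ _
    _ ≤ (M * ENNReal.ofReal 16 ^ m + 1) * (η * ENNReal.ofReal (2 * (2 * s)) ^ m) := by
        rw [hzero, add_zero]
        refine hW.trans ?_
        gcongr
        exact le_self_add
    _ = (k + 1 : ℝ≥0∞)⁻¹ * ENNReal.ofReal s ^ m := by
        rw [show 2 * (2 * s) = 4 * s by ring, ENNReal.ofReal_mul (by norm_num), mul_pow, hη,
          ENNReal.ofReal_ofNat 4, ← mul_assoc, ← mul_assoc, mul_assoc _ _ ((4 : ℝ≥0∞) ^ m),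
          ENNReal.div_mul_cancel (by simp) (by finiteness), ENNReal.mul_div_cancel hpos1 hfin1]

theorem isClosed_setOf_exists_mem_compact {P X : Type*} [TopologicalSpace P] [TopologicalSpace X]
    {A : Set X} (hA : IsCompact A) {F : Set (X × P)} (hF : IsClosed F) :
    IsClosed {p | ∃ x ∈ A, (x, p) ∈ F} := by
  have := isCompact_iff_compactSpace.1 hA
  convert isClosedMap_snd_of_compactSpace (X := A) (Y := P)
    {q | ((q.1 : X), q.2) ∈ F} (hF.preimage (by fun_prop)) using 1
  ext p
  constructor
  · rintro ⟨x, hx, h⟩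
    exact ⟨(⟨x, hx⟩, p), h, rfl⟩
  · rintro ⟨⟨x, q⟩, h, rfl⟩
    exact ⟨x, x.2, h⟩

/-- The fibre of `colMap L` through `a` contains a nearby point of `A`. -/
def HasNearbyFiberPoint {N m : ℕ} (A : Set (Fin N → ℝ)) (p : ℕ) (a : Fin N → ℝ)
    (L : Fin N → Fin m → ℝ) : Prop :=
  ∃ x ∈ A, x ≠ a ∧ dist x a ≤ (1 / 2) ^ p ∧ colMap L x = colMap L a

/-- The coordinate cones at `a` have unbounded normalized `Hᵐ` densities in `A`. -/
def HasUnboundedConeDensity {N m : ℕ} (A : Set (Fin N → ℝ)) (j : Fin N) (a : Fin N → ℝ)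
    (L : Fin N → Fin m → ℝ) : Prop :=
  ∀ M : ℕ, ∃ i l, M * ENNReal.ofReal ((1 / 2) ^ i * (1 / 2) ^ l) ^ m <
    μH[m].restrict A (coordCone L j a ((1 / 2) ^ i) ((1 / 2) ^ l))

/-- The coordinate cones at `a` have uniformly vanishing normalized `Hᵐ` densities in `A`. -/
def HasZeroConeDensity {N m : ℕ} (A : Set (Fin N → ℝ)) (p : ℕ) (j : Fin N) (a : Fin N → ℝ)
    (L : Fin N → Fin m → ℝ) : Prop :=
  ∀ k : ℕ, ∃ l₀, ∀ l ≥ l₀, ∀ i ≥ p,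
    μH[m].restrict A (coordCone L j a ((1 / 2) ^ i) ((1 / 2) ^ l)) ≤
      (k + 1 : ℝ≥0∞)⁻¹ * ENNReal.ofReal ((1 / 2) ^ i * (1 / 2) ^ l) ^ m

section Measurability

variable {N m : ℕ} {A : Set (Fin N → ℝ)}

theorem measurable_measure_coordCone (hfin : μH[m] A ≠ ⊤) (j : Fin N) (r s : ℝ) :
    Measurable fun q : (Fin N → ℝ) × (Fin N → Fin m → ℝ) =>
      μH[m].restrict A (coordCone q.2 j q.1 r s) := by
  have : IsFiniteMeasure (μH[m].restrict A) := ⟨by simpa using hfin.lt_top⟩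
  exact measurable_measure_prodMk_left (measurableSet_setOf_mem_coordCone (m := m) j r s)

theorem measurableSet_hasNearbyFiberPoint (hA : IsCompact A) (p : ℕ) :
    MeasurableSet {q : (Fin N → ℝ) × (Fin N → Fin m → ℝ) |
      HasNearbyFiberPoint A p q.1 q.2} := by
  have : {q : (Fin N → ℝ) × (Fin N → Fin m → ℝ) | HasNearbyFiberPoint A p q.1 q.2} =
      ⋃ k : ℕ, {q | ∃ x ∈ A, (x, q) ∈ {w : (Fin N → ℝ) × (Fin N → ℝ) × (Fin N → Fin m → ℝ) |
        (1 / 2 : ℝ) ^ k ≤ dist w.1 w.2.1 ∧ dist w.1 w.2.1 ≤ (1 / 2) ^ p ∧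
          colMap w.2.2 w.1 = colMap w.2.2 w.2.1}} := by
    ext q
    simp only [mem_ofPred_eq, mem_iUnion]
    constructor
    · rintro ⟨x, hx, hne, hd, h⟩
      obtain ⟨k, hk⟩ := exists_pow_lt_of_lt_one (dist_pos.2 hne) (by norm_num : (1 / 2 : ℝ) < 1)
      exact ⟨k, x, hx, hk.le, hd, h⟩
    · rintro ⟨k, x, hx, hk, hd, h⟩
      exact ⟨x, hx, dist_pos.1 (lt_of_lt_of_le (by positivity) hk), hd, h⟩
  rw [this]
  refine MeasurableSet.iUnion fun k => (isClosed_setOf_exists_mem_compact hA ?_).measurableSet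
  have h1 : IsClosed {w : (Fin N → ℝ) × (Fin N → ℝ) × (Fin N → Fin m → ℝ) |
      (1 / 2 : ℝ) ^ k ≤ dist w.1 w.2.1} := isClosed_le (by fun_prop) (by fun_prop)
  have h2 : IsClosed {w : (Fin N → ℝ) × (Fin N → ℝ) × (Fin N → Fin m → ℝ) |
      dist w.1 w.2.1 ≤ (1 / 2) ^ p} := isClosed_le (by fun_prop) (by fun_prop)
  refine h1.inter (h2.inter (isClosed_eq ?_ ?_))
  · exact continuous_colMap.comp (f := fun w : (Fin N → ℝ) × (Fin N → ℝ) × (Fin N → Fin m → ℝ) =>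
      (w.2.2, w.1)) (by fun_prop)
  · exact continuous_colMap.comp (f := fun w : (Fin N → ℝ) × (Fin N → ℝ) × (Fin N → Fin m → ℝ) =>
      (w.2.2, w.2.1)) (by fun_prop)

theorem measurableSet_hasUnboundedConeDensity (hfin : μH[m] A ≠ ⊤) (j : Fin N) :
    MeasurableSet {q : (Fin N → ℝ) × (Fin N → Fin m → ℝ) |
      HasUnboundedConeDensity A j q.1 q.2} := by
  simp only [HasUnboundedConeDensity, ofPred_forall, ofPred_exists]
  exact .iInter fun M => .iUnion fun i => .iUnion fun l =>
    measurableSet_lt measurable_const (measurable_measure_coordCone hfin _ _ _)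

theorem measurableSet_hasZeroConeDensity (hfin : μH[m] A ≠ ⊤) (p : ℕ) (j : Fin N) :
    MeasurableSet {q : (Fin N → ℝ) × (Fin N → Fin m → ℝ) |
      HasZeroConeDensity A p j q.1 q.2} := by
  simp only [HasZeroConeDensity, ofPred_forall, ofPred_exists]
  exact .iInter fun k => .iUnion fun l₀ => .iInter fun l => .iInter fun _ => .iInter fun i =>
    .iInter fun _ => measurableSet_le (measurable_measure_coordCone hfin _ _ _) measurable_const

end Measurability

theorem colMap_add_single {N m : ℕ} (L : Fin N → Fin m → ℝ) (j : Fin N) (t : Fin m → ℝ)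
    (x : Fin N → ℝ) : colMap (L + Pi.single j t) x = colMap L x + x j • t := by
  simp only [colMap, Pi.add_apply, smul_add, Finset.sum_add_distrib]
  congr 1
  rw [Finset.sum_eq_single j]
  · simp
  · intro k _ hk
    simp [Pi.single_eq_of_ne hk]
  · simp

/-- Alternatives for almost every value of a single column. -/
theorem ae_single_column_alternative {N m : ℕ} {A : Set (Fin N → ℝ)} (hA : IsCompact A)
    (a : Fin N → ℝ) (L : Fin N → Fin m → ℝ) (j : Fin N) (p : ℕ) :
    ∀ᵐ t : Fin m → ℝ, ¬ HasNearbyFiberPoint A p a (L + Pi.single j t) →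
      ¬ HasUnboundedConeDensity A j a (L + Pi.single j t) →
      HasZeroConeDensity A p j a (L + Pi.single j t) := by
  let θ : (Fin N → ℝ) → Fin m → ℝ := fun x => -((x j - a j)⁻¹ • colMap L (x - a))
  have hθm : Measurable θ := by
    have h : Measurable fun x : Fin N → ℝ => x j - a j := by fun_prop
    refine (h.inv.smul ?_).neg
    exact ((continuous_colMap_right L).comp (by fun_prop)).measurable
  have hθball : ∀ (t : Fin m → ℝ) (x : Fin N → ℝ) (s : ℝ), x j ≠ a j →
      (θ x ∈ closedBall t s ↔ ‖colMap (L + Pi.single j t) (x - a)‖ ≤ s * |x j - a j|) := by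
    intro t x s hx
    have hne : x j - a j ≠ 0 := sub_ne_zero.2 hx
    have h1 : colMap (L + Pi.single j t) (x - a) = (x j - a j) • (t - θ x) := by
      rw [colMap_add_single]
      simp only [θ, sub_neg_eq_add, smul_add, smul_inv_smul₀ hne, Pi.sub_apply]
      abel
    rw [h1, norm_smul, Real.norm_eq_abs, mem_closedBall, dist_comm, dist_eq_norm, mul_comm s,
      mul_le_mul_iff_right₀ (abs_pos.2 hne)]
  set U : ℕ → Set (Fin N → ℝ) := fun i => closedBall a ((1 / 2) ^ i) ∩ {x | x j ≠ a j} with hU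
  have hopen : IsOpen {x : Fin N → ℝ | x j ≠ a j} := isOpen_ne_fun (by fun_prop) (by fun_prop)
  have hUm : ∀ i, MeasurableSet (U i) := fun i =>
    measurableSet_closedBall.inter hopen.measurableSet
  have hUcone : ∀ t i (s : ℝ), θ ⁻¹' closedBall t s ∩ U i =
      coordCone (L + Pi.single j t) j a ((1 / 2) ^ i) s := by
    intro t i s
    ext x
    constructor
    · rintro ⟨h1, h2, h3⟩
      exact ⟨h2, h3, (hθball t x s h3).1 h1⟩
    · rintro ⟨h1, h2, h3⟩
      exact ⟨(hθball t x s h2).2 h3, h1, h2⟩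
  let Θ : Set (Fin m → ℝ) := θ '' (A ∩ U p)
  have hΘ : MeasurableSet Θ := by
    have hcov : A ∩ U p = ⋃ k : ℕ, A ∩ closedBall a ((1 / 2) ^ p) ∩
        {x | (1 / 2 : ℝ) ^ k ≤ |x j - a j|} := by
      ext x
      simp only [hU, mem_inter_iff, mem_iUnion, mem_ofPred_eq]
      constructor
      · rintro ⟨h1, h2, h3⟩
        obtain ⟨k, hk⟩ := exists_pow_lt_of_lt_one (abs_pos.2 (sub_ne_zero.2 h3))
          (by norm_num : (1 / 2 : ℝ) < 1)
        exact ⟨k, ⟨h1, h2⟩, hk.le⟩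
      · rintro ⟨k, ⟨h1, h2⟩, h3⟩
        refine ⟨h1, h2, sub_ne_zero.1 (abs_pos.1 (lt_of_lt_of_le (by positivity) h3))⟩
    have : Θ = ⋃ k : ℕ, θ '' (A ∩ closedBall a ((1 / 2) ^ p) ∩
        {x | (1 / 2 : ℝ) ^ k ≤ |x j - a j|}) := by
      rw [← image_iUnion, ← hcov]
    rw [this]
    refine MeasurableSet.iUnion fun k => IsCompact.measurableSet (IsCompact.image_of_continuousOn
      ((hA.inter_right isClosed_closedBall).inter_right
        (isClosed_le (by fun_prop) (by fun_prop))) ?_)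
    have h : Continuous fun x : Fin N → ℝ => x j - a j := by fun_prop
    refine (ContinuousOn.smul (ContinuousOn.inv₀ h.continuousOn ?_) ?_).neg
    · intro x hx
      exact abs_pos.1 (lt_of_lt_of_le (by positivity) hx.2)
    · exact ((continuous_colMap_right L).comp (by fun_prop)).continuousOn
  let ν : ℕ → Measure (Fin m → ℝ) := fun i =>
    (ENNReal.ofReal ((1 / 2) ^ (i + p)) ^ m)⁻¹ •
      ((μH[m].restrict A).restrict (U (i + p))).map θ
  have hc0 : ∀ i, ENNReal.ofReal ((1 / 2) ^ i) ^ m ≠ 0 := fun i => by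
    have : 0 < ENNReal.ofReal ((1 / 2) ^ i) := ENNReal.ofReal_pos.2 (by positivity)
    positivity
  have hct : ∀ i, ENNReal.ofReal ((1 / 2) ^ i) ^ m ≠ ⊤ := fun i => by finiteness
  have hνball : ∀ t i l, ν i (closedBall t ((1 / 2) ^ l)) =
      (ENNReal.ofReal ((1 / 2) ^ (i + p)) ^ m)⁻¹ * μH[m].restrict A
        (coordCone (L + Pi.single j t) j a ((1 / 2) ^ (i + p)) ((1 / 2) ^ l)) := by
    intro t i l
    simp only [ν, Measure.smul_apply, smul_eq_mul]
    rw [Measure.map_apply hθm measurableSet_closedBall,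
      Measure.restrict_apply (hθm measurableSet_closedBall), hUcone]
  have hνΘ : ∀ i, ν i Θᶜ = 0 := by
    intro i
    simp only [ν, Measure.smul_apply, smul_eq_mul]
    rw [Measure.map_apply hθm hΘ.compl, Measure.restrict_apply (hθm hΘ.compl),
      Measure.restrict_apply ((hθm hΘ.compl).inter (hUm _))]
    convert mul_zero _
    convert measure_empty (μ := (μH[m] : Measure (Fin N → ℝ)))
    refine eq_empty_iff_forall_notMem.2 ?_
    rintro x ⟨⟨h1, h2⟩, h3⟩
    refine h1 ⟨x, ⟨h3, ?_, h2.2⟩, rfl⟩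
    exact closedBall_subset_closedBall
      (pow_le_pow_of_le_one (by norm_num) (by norm_num) (Nat.le_add_left _ _)) h2.1
  have hmul : ∀ i l : ℕ, ENNReal.ofReal ((1 / 2) ^ i * (1 / 2) ^ l) ^ m =
      ENNReal.ofReal ((1 / 2) ^ i) ^ m * ENNReal.ofReal ((1 / 2) ^ l) ^ m := by
    intro i l
    rw [ENNReal.ofReal_mul (by positivity), mul_pow]
  filter_upwards [ae_density_zero_of_bounded ν hΘ hνΘ] with t ht hQ hD
  have htΘ : t ∉ Θ := by
    rintro ⟨x, ⟨hxA, hx1, hx2⟩, hxt⟩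
    refine hQ ⟨x, hxA, fun h => hx2 (by rw [h]), hx1, ?_⟩
    have := (hθball t x 0 hx2).1 (by rw [hxt]; simp)
    rw [zero_mul, norm_le_zero_iff, colMap_sub, sub_eq_zero] at this
    exact this
  unfold HasUnboundedConeDensity at hD
  push Not at hD
  obtain ⟨M, hM⟩ := hD
  have hz := ht htΘ M (by
    intro i l
    rw [hνball, ENNReal.inv_mul_le_iff (hc0 _) (hct _)]
    refine (hM (i + p) l).trans (le_of_eq ?_)
    rw [hmul]
    ring)
  intro k
  obtain ⟨l₀, hl₀⟩ := hz k
  refine ⟨l₀, fun l hl i hi => ?_⟩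
  have := hl₀ l hl (i - p)
  rw [hνball, ENNReal.inv_mul_le_iff (hc0 _) (hct _), Nat.sub_add_cancel hi] at this
  refine this.trans (le_of_eq ?_)
  rw [hmul]
  ring

/-- **Besicovitch–Federer projection theorem** for compact sets: almost every linear image of a
set without Lipschitz pieces is null. -/
theorem ae_volume_colMap_image_eq_zero {N m : ℕ} {A : Set (Fin N → ℝ)} (hAc : IsCompact A)
    (hfin : μH[m] A ≠ ⊤) (hA : NoLipschitzPiece m A) :
    ∀ᵐ L : Fin N → Fin m → ℝ, volume (colMap L '' A) = 0 := by
  have hμfin : IsFiniteMeasure (μH[m].restrict A) := ⟨by simpa using hfin.lt_top⟩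
  -- the exceptional set of pairs
  let S : Set ((Fin N → ℝ) × (Fin N → Fin m → ℝ)) :=
    ⋃ p : ℕ, ⋃ j : Fin N, {q | ¬ HasNearbyFiberPoint A p q.1 q.2 ∧
      ¬ HasUnboundedConeDensity A j q.1 q.2 ∧ ¬ HasZeroConeDensity A p j q.1 q.2}
  have hSm' : ∀ (p : ℕ) (j : Fin N), MeasurableSet
      {q : (Fin N → ℝ) × (Fin N → Fin m → ℝ) | ¬ HasNearbyFiberPoint A p q.1 q.2 ∧
      ¬ HasUnboundedConeDensity A j q.1 q.2 ∧ ¬ HasZeroConeDensity A p j q.1 q.2} := fun p j =>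
    (measurableSet_hasNearbyFiberPoint hAc p).compl.inter
      ((measurableSet_hasUnboundedConeDensity hfin j).compl.inter
        (measurableSet_hasZeroConeDensity hfin p j).compl)
  have hSm : MeasurableSet S := .iUnion fun p => .iUnion fun j => hSm' p j
  have hslice : ∀ a, volume (Prod.mk a ⁻¹' S) = 0 := by
    intro a
    simp only [S, preimage_iUnion]
    refine measure_iUnion_null fun p => measure_iUnion_null fun j => ?_
    refine measure_eq_zero_of_forall_ae_add_notMem (ν := (volume : Measure (Fin m → ℝ)))
      (B := fun t => Pi.single j t) ?_ ((hSm' p j).preimage measurable_prodMk_left) ?_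
    · exact (continuous_single j).measurable
    · intro L
      filter_upwards [ae_single_column_alternative hAc a L j p] with t ht h
      exact h.2.2 (ht h.1 h.2.1)
  have hS0 : ((μH[m].restrict A).prod volume) S = 0 := by
    rw [Measure.measure_prod_null hSm]
    exact Eventually.of_forall hslice
  have hS1 : (volume.prod (μH[m].restrict A)) (Prod.swap ⁻¹' S) = 0 := by
    rw [← Measure.map_apply measurable_swap hSm, Measure.prod_swap, hS0]
  rw [Measure.measure_prod_null (hSm.preimage measurable_swap)] at hS1
  filter_upwards [hS1] with L hL
  have hL0 : μH[m] ({a | (a, L) ∈ S} ∩ A) = 0 := by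
    exact (Measure.restrict_apply (μ := μH[m]) (s := A)
      (hSm.preimage (measurable_prodMk_right (y := L)))).symm.trans hL
  have hlip := lipschitzWith_colMap L
  have himage : ∀ T : Set (Fin N → ℝ), μH[m] T = 0 → volume (colMap L '' T) = 0 := by
    intro T hT
    rw [volume_eq_hausdorffMeasure_fin]
    refine le_antisymm ((hlip.hausdorffMeasure_image_le (by positivity) T).trans ?_) bot_le
    rw [hT, mul_zero]
  have hunb : volume (colMap L '' {a | ∃ j, HasUnboundedConeDensity A j a L}) = 0 := by
    have hae := ae_exists_forall_measure_closedBall_le ((μH[m].restrict A).map (colMap L))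
    refine measure_mono_null ?_ hae
    rintro _ ⟨a, ⟨j, hj⟩, rfl⟩ ⟨M, hM⟩
    obtain ⟨i, l, hil⟩ := hj M
    refine absurd hil (not_lt.2 (le_trans ?_ (hM _ (by positivity))))
    rw [Measure.map_apply (continuous_colMap_right L).measurable measurableSet_closedBall]
    refine measure_mono fun x hx => ?_
    rw [mem_preimage, mem_closedBall, dist_eq_norm, ← colMap_sub]
    refine hx.2.2.trans ?_
    rw [mul_comm]
    gcongr
    rw [← Real.dist_eq]
    exact (dist_le_pi_dist x a j).trans hx.1
  have hfib : volume (colMap L '' {a | a ∈ A ∧ ∀ p, HasNearbyFiberPoint A p a L}) = 0 := by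
    refine measure_mono_null ?_ (volume_setOf_infinite_fiber hfin hAc.measurableSet hlip)
    rintro _ ⟨a, ⟨ha, hp⟩, rfl⟩
    intro hF
    have hF' := (hF.subset (sdiff_subset (t := {a}))).isClosed
    have hmem : a ∈ (A ∩ colMap L ⁻¹' {colMap L a}) \ {a} := by
      refine (hF'.closure_eq ▸ Metric.mem_closure_iff.2 fun ε hε => ?_ :)
      obtain ⟨p, hpε⟩ := exists_pow_lt_of_lt_one hε (by norm_num : (1 / 2 : ℝ) < 1)
      obtain ⟨x, hxA, hne, hd, hx⟩ := hp p
      exact ⟨x, ⟨⟨hxA, hx⟩, hne⟩, by rw [dist_comm]; linarith⟩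
    exact hmem.2 rfl
  have hzero : volume (colMap L '' ⋃ p : ℕ, {a ∈ A | ∀ j, HasZeroConeDensity A p j a L}) = 0 := by
    refine himage _ (measure_iUnion_null fun p => ?_)
    exact hausdorffMeasure_setOf_coordCone_density_zero hA hAc L p
  refine measure_mono_null (t := (colMap L '' ({a | (a, L) ∈ S} ∩ A)) ∪
    ((colMap L '' {a | ∃ j, HasUnboundedConeDensity A j a L}) ∪
    ((colMap L '' {a | a ∈ A ∧ ∀ p, HasNearbyFiberPoint A p a L}) ∪
      (colMap L '' ⋃ p : ℕ, {a ∈ A | ∀ j, HasZeroConeDensity A p j a L})))) ?_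
    (measure_union_null (himage _ hL0) (measure_union_null hunb (measure_union_null hfib hzero)))
  simp only [← image_union]
  refine image_mono fun a ha => ?_
  by_contra hcon
  simp only [mem_union, mem_inter_iff, mem_ofPred_eq, not_or, not_and, mem_iUnion, not_exists,
    not_forall, S] at hcon
  obtain ⟨h1, h2, h3, h4⟩ := hcon
  obtain ⟨p, hp⟩ := h3 ha
  obtain ⟨j, hj⟩ := h4 p ha
  refine h1 ?_ ha
  exact ⟨p, j, hp, h2 j, hj⟩

theorem exists_lipschitzOnWith_inv_smul {E : Type*} [NormedAddCommGroup E] [NormedSpace ℝ E]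
    {w : E → ℝ} {S : Set E} {K : NNReal} {r : ℝ} (hr : 0 < r) (hS : Bornology.IsBounded S)
    (hw : LipschitzOnWith K w S) (hwr : ∀ x ∈ S, r ≤ |w x|) :
    ∃ C, LipschitzOnWith C (fun x => (w x)⁻¹ • x) S := by
  obtain ⟨M, hM0, hM⟩ := hS.exists_pos_norm_le
  refine ⟨Real.toNNReal (r⁻¹ + K * M * (r⁻¹ * r⁻¹)), LipschitzOnWith.of_dist_le_mul ?_⟩
  intro x hx y hy
  rw [Real.coe_toNNReal _ (by positivity)]
  have hx0 : w x ≠ 0 := abs_pos.1 (hr.trans_le (hwr x hx))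
  have hy0 : w y ≠ 0 := abs_pos.1 (hr.trans_le (hwr y hy))
  have hxi : |w x|⁻¹ ≤ r⁻¹ := inv_anti₀ hr (hwr x hx)
  have hyi : |w y|⁻¹ ≤ r⁻¹ := inv_anti₀ hr (hwr y hy)
  have h1 : (w x)⁻¹ • x - (w y)⁻¹ • y = (w x)⁻¹ • (x - y) +
      ((w y - w x) * ((w x)⁻¹ * (w y)⁻¹)) • y := by
    have : (w y - w x) * ((w x)⁻¹ * (w y)⁻¹) = (w x)⁻¹ - (w y)⁻¹ := by field_simp
    rw [this, smul_sub, sub_smul]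
    abel
  have h2 : |w y - w x| ≤ K * dist x y := by
    rw [← Real.dist_eq, dist_comm x y]
    exact hw.dist_le_mul y hy x hx
  rw [dist_eq_norm, h1]
  refine (norm_add_le _ _).trans ?_
  rw [norm_smul, norm_smul, norm_inv, norm_mul, norm_mul, norm_inv, norm_inv, Real.norm_eq_abs,
    Real.norm_eq_abs, Real.norm_eq_abs, ← dist_eq_norm x y]
  calc |w x|⁻¹ * dist x y + |w y - w x| * (|w x|⁻¹ * |w y|⁻¹) * ‖y‖
      ≤ r⁻¹ * dist x y + K * dist x y * (r⁻¹ * r⁻¹) * M := by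
        gcongr
        exact hM y hy
    _ = _ := by ring

theorem NoLipschitzPiece.of_lipschitzOnWith {X Y : Type*} [MetricSpace X] [MeasurableSpace X]
    [BorelSpace X] [MetricSpace Y] [MeasurableSpace Y] [BorelSpace Y] {m : ℕ} {A : Set X}
    (hA : NoLipschitzPiece m A) {A' : Set Y} {g : Y → X} {φ : X → Y} {K K' : NNReal}
    (hg : LipschitzOnWith K g A') (hφ : LipschitzOnWith K' φ (g '' A'))
    (hmaps : MapsTo g A' A) (hleft : LeftInvOn φ g A') : NoLipschitzPiece m A' := by
  intro S f C hf hfS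
  have h1 : μH[m] ((g ∘ f) '' S) = 0 := by
    refine hA S (g ∘ f) (K * C) (hg.comp hf (mapsTo_iff_image_subset.2 hfS)) ?_
    rw [image_comp]
    exact (image_mono hfS).trans hmaps.image_subset
  have h2 : f '' S = φ '' ((g ∘ f) '' S) := by
    rw [image_comp, hleft.image_image' hfS]
  rw [h2]
  refine le_antisymm (((hφ.mono ?_).hausdorffMeasure_image_le (by positivity)).trans ?_) bot_le
  · rw [image_comp]
    exact image_mono hfS
  · rw [h1, mul_zero]

theorem colMap_smul {N m : ℕ} (L : Fin N → Fin m → ℝ) (c : ℝ) (x : Fin N → ℝ) :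
    colMap L (c • x) = c • colMap L x := by
  simp [colMap, mul_smul, Finset.smul_sum]

theorem colMap_apply {N m : ℕ} (L : Fin N → Fin m → ℝ) (x : Fin N → ℝ) (i : Fin m) :
    colMap L x i = ∑ k, x k * L k i := by
  simp [colMap]

/-- The central projection determined by the coordinates `σ i` and `j` of `colMap P`. -/
def centralProj {N n m : ℕ} (P : Fin N → Fin n → ℝ) (σ : Fin m → Fin n) (j : Fin n)
    (x : Fin N → ℝ) : Fin m → ℝ := fun i => colMap P x (σ i) / colMap P x j

theorem measurableSet_setOf_volume_centralProj {N n m : ℕ} {A : Set (Fin N → ℝ)}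
    (hA : IsCompact A) (σ : Fin m → Fin n) (j : Fin n) {r : ℝ} (hr : 0 < r) :
    MeasurableSet {P : Fin N → Fin n → ℝ |
      volume (centralProj P σ j '' {x ∈ A | r ≤ |colMap P x j|}) = 0} := by
  let F : Set ((Fin N → ℝ) × (Fin N → Fin n → ℝ) × (Fin m → ℝ)) :=
    {q | r ≤ |colMap q.2.1 q.1 j| ∧ ∀ i, q.2.2 i * colMap q.2.1 q.1 j = colMap q.2.1 q.1 (σ i)}
  have hc : ∀ i, Continuous fun q : (Fin N → ℝ) × (Fin N → Fin n → ℝ) × (Fin m → ℝ) =>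
      colMap q.2.1 q.1 i := fun i => by
    simp only [colMap_apply]; fun_prop
  have hF : IsClosed F := by
    have h1 : IsClosed {q : (Fin N → ℝ) × (Fin N → Fin n → ℝ) × (Fin m → ℝ) |
      r ≤ |colMap q.2.1 q.1 j|} := isClosed_le continuous_const (hc j).abs
    have h2 : IsClosed {q : (Fin N → ℝ) × (Fin N → Fin n → ℝ) × (Fin m → ℝ) |
        ∀ i, q.2.2 i * colMap q.2.1 q.1 j = colMap q.2.1 q.1 (σ i)} := by
      rw [ofPred_forall]
      refine isClosed_iInter fun i => isClosed_eq ?_ (hc _)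
      exact Continuous.mul (by fun_prop) (hc j)
    exact h1.inter h2
  have hm := (isClosed_setOf_exists_mem_compact hA hF).measurableSet
  have := measurable_measure_prodMk_left (ν := (volume : Measure (Fin m → ℝ))) hm
  convert this (measurableSet_singleton 0) using 1
  ext P
  simp only [mem_preimage, mem_singleton_iff, mem_ofPred_eq]
  congr! 2
  ext y
  simp only [mem_image, mem_preimage, mem_ofPred_eq, F]
  constructor
  · rintro ⟨x, ⟨hx, hxr⟩, rfl⟩
    have h0 : colMap P x j ≠ 0 := abs_pos.1 (hr.trans_le hxr)
    exact ⟨x, hx, hxr, fun i => div_mul_cancel₀ _ h0⟩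
  · rintro ⟨x, hx, hxr, h⟩
    have h0 : colMap P x j ≠ 0 := abs_pos.1 (hr.trans_le hxr)
    exact ⟨x, ⟨hx, hxr⟩, funext fun i => (eq_div_of_mul_eq h0 (h i)).symm⟩

theorem ae_volume_centralProj_image_eq_zero {N n m : ℕ} {A : Set (Fin N → ℝ)} (hAc : IsCompact A)
    (hfin : μH[m] A ≠ ⊤) (hA : NoLipschitzPiece m A) {k₀ : Fin N} (hone : ∀ x ∈ A, x k₀ = 1)
    {σ : Fin m → Fin n} (hσ : Function.Injective σ) {j : Fin n} (hj : j ∉ range σ)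
    {r : ℝ} (hr : 0 < r) :
    ∀ᵐ P : Fin N → Fin n → ℝ,
      volume (centralProj P σ j '' {x ∈ A | r ≤ |colMap P x j|}) = 0 := by
  rw [ae_iff]
  let B : (Fin N → Fin m → ℝ) → Fin N → Fin n → ℝ := fun L k => Function.extend σ (L k) 0
  have hBσ : ∀ L k i, B L k (σ i) = L k i := fun L k i => hσ.extend_apply _ _ _
  have hBj : ∀ L k, B L k j = 0 := fun L k => Function.extend_apply' _ _ _ (by simpa using hj)
  have hB : Measurable B := by
    refine measurable_pi_lambda _ fun k => measurable_pi_lambda _ fun i => ?_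
    by_cases h : ∃ a, σ a = i
    · obtain ⟨a, rfl⟩ := h
      simp only [hBσ]
      fun_prop
    · simp only [B, Function.extend_apply' _ _ _ h]
      fun_prop
  refine measure_eq_zero_of_forall_ae_add_notMem
    (ν := (volume : Measure (Fin N → Fin m → ℝ))) hB
    (measurableSet_setOf_volume_centralProj hAc σ j hr).compl fun P => ?_
  set D : Set (Fin N → ℝ) := {x ∈ A | r ≤ |colMap P x j|} with hD
  have hwc : Continuous fun x : Fin N → ℝ => colMap P x j := by
    simp only [colMap_apply]; fun_prop
  have hDc : IsCompact D := hAc.inter_right (isClosed_le continuous_const hwc.abs)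
  have hw : LipschitzWith (∑ k, ‖P k‖₊) fun x : Fin N → ℝ => colMap P x j := by
    have := (LipschitzWith.eval j).comp (lipschitzWith_colMap P)
    rwa [one_mul] at this
  set φ : (Fin N → ℝ) → Fin N → ℝ := fun x => (colMap P x j)⁻¹ • x with hφ
  obtain ⟨C, hC⟩ := exists_lipschitzOnWith_inv_smul hr hDc.isBounded hw.lipschitzOnWith
    (fun x hx => hx.2)
  have hA'c : IsCompact (φ '' D) := hDc.image_of_continuousOn hC.continuousOn
  have hA'fin : μH[m] (φ '' D) ≠ ⊤ := by
    refine ((hC.hausdorffMeasure_image_le (by positivity)).trans_lt ?_).ne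
    refine ENNReal.mul_lt_top (by simp) ?_
    exact (measure_mono (fun x hx => hx.1)).trans_lt hfin.lt_top
  obtain ⟨M, hM0, hM⟩ := (hDc.image hwc).isBounded.exists_pos_norm_le
  have hy0 : ∀ y ∈ φ '' D, M⁻¹ ≤ |y k₀| := by
    rintro _ ⟨x, hx, rfl⟩
    have h0 : colMap P x j ≠ 0 := abs_pos.1 (hr.trans_le hx.2)
    simp only [hφ, Pi.smul_apply, hone x hx.1, smul_eq_mul, mul_one, abs_inv]
    exact inv_anti₀ (abs_pos.2 h0) (hM _ ⟨x, hx, rfl⟩)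
  obtain ⟨C', hC'⟩ := exists_lipschitzOnWith_inv_smul (w := fun y : Fin N → ℝ => y k₀)
    (inv_pos.2 hM0) hA'c.isBounded (LipschitzWith.eval k₀).lipschitzOnWith hy0
  have hinv : ∀ x ∈ D, (φ x k₀)⁻¹ • φ x = x := by
    intro x hx
    have h0 : colMap P x j ≠ 0 := abs_pos.1 (hr.trans_le hx.2)
    simp only [hφ, Pi.smul_apply, hone x hx.1, smul_eq_mul, mul_one, inv_inv, smul_inv_smul₀ h0]
  have himg : (fun y : Fin N → ℝ => (y k₀)⁻¹ • y) '' (φ '' D) ⊆ D := by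
    rintro _ ⟨_, ⟨x, hx, rfl⟩, rfl⟩
    simpa only [hinv x hx] using hx
  have hA' : NoLipschitzPiece m (φ '' D) := by
    refine hA.of_lipschitzOnWith hC' (hC.mono himg) ?_ ?_
    · exact fun y hy => (himg ⟨y, hy, rfl⟩).1
    · rintro _ ⟨x, hx, rfl⟩
      simp only [hinv x hx]
      rfl
  have hae := ae_volume_colMap_image_eq_zero hA'c hA'fin hA'
  have hshift := (measurePreserving_add_left (volume : Measure (Fin N → Fin m → ℝ))
    (fun k i => P k (σ i))).quasiMeasurePreserving.ae hae
  filter_upwards [hshift] with L hL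
  rw [not_not]
  have hj' : ∀ x, colMap (P + B L) x j = colMap P x j := fun x => by
    simp [colMap_apply, hBj]
  simp only [hj']
  refine measure_mono_null ?_ hL
  rintro _ ⟨x, hx, rfl⟩
  refine ⟨φ x, ⟨x, hx, rfl⟩, ?_⟩
  ext i
  simp only [hφ, colMap_smul, Pi.smul_apply, smul_eq_mul, centralProj, hj']
  rw [div_eq_inv_mul]
  congr 1
  simp [colMap_apply, hBσ]

theorem ae_forall_volume_shifted_centralProj {N n m : ℕ} {A : Set (Fin N → ℝ)}
    (hAc : IsCompact A) (hfin : μH[m] A ≠ ⊤) (hA : NoLipschitzPiece m A) {k₀ : Fin N}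
    (hone : ∀ x ∈ A, x k₀ = 1) :
    ∀ᵐ P : Fin N → Fin n → ℝ, ∀ (c : Fin n → ℤ) (σ : Fin m → Fin n), Function.Injective σ →
      ∀ j ∉ range σ, volume ((fun x i => (colMap P x (σ i) - 2 * c (σ i)) /
        (colMap P x j - 2 * c j)) '' {x ∈ A | colMap P x j - 2 * c j ≠ 0}) = 0 := by
  simp only [ae_all_iff]
  intro c σ hσ j hj
  have hshift : ∀ q : ℕ, ∀ᵐ P : Fin N → Fin n → ℝ, _ := fun q =>
    (measurePreserving_add_right (volume : Measure (Fin N → Fin n → ℝ))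
      (Pi.single k₀ fun i => -(2 * c i : ℝ))).quasiMeasurePreserving.ae
      (ae_volume_centralProj_image_eq_zero hAc hfin hA hone hσ hj
        (r := 1 / ((q : ℝ) + 1)) (by positivity))
  rw [← ae_all_iff] at hshift
  filter_upwards [hshift] with P hP
  have hcol : ∀ x ∈ A, ∀ i, colMap (P + Pi.single k₀ fun i => -(2 * c i : ℝ)) x i =
      colMap P x i - 2 * c i := by
    intro x hx i
    rw [colMap_add_single, hone x hx]
    simp [sub_eq_add_neg]
  refine measure_mono_null ?_ (measure_iUnion_null hP)
  rintro _ ⟨x, ⟨hx, hne⟩, rfl⟩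
  obtain ⟨q, hq⟩ := exists_nat_one_div_lt (abs_pos.2 hne)
  refine mem_iUnion.2 ⟨q, x, ⟨hx, ?_⟩, ?_⟩
  · rw [hcol x hx]
    exact hq.le
  · ext i
    simp only [centralProj, hcol x hx]

/-- The signed distance from `u` to the nearest even integer. -/
def evenDev (u : ℝ) : ℝ := u - 2 * round (u / 2)

theorem abs_evenDev_le (u : ℝ) (k : ℤ) : |evenDev u| ≤ |u - 2 * k| := by
  have h := round_le (u / 2) k
  have h1 : evenDev u = 2 * (u / 2 - round (u / 2)) := by unfold evenDev; ring
  have h2 : u - 2 * k = 2 * (u / 2 - k) := by ring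
  rw [h1, h2, abs_mul, abs_mul]
  gcongr

theorem abs_evenDev_le_one (u : ℝ) : |evenDev u| ≤ 1 := by
  have h := abs_sub_round (u / 2)
  have h1 : evenDev u = 2 * (u / 2 - round (u / 2)) := by unfold evenDev; ring
  rw [h1, abs_mul, abs_two]
  linarith

theorem abs_evenDev_le_add (u u' : ℝ) : |evenDev u| ≤ |evenDev u'| + |u - u'| := by
  refine (abs_evenDev_le u (round (u' / 2))).trans ?_
  have : u - 2 * round (u' / 2) = evenDev u' + (u - u') := by unfold evenDev; ring
  rw [this]
  exact abs_add_le _ _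

/-- Truncation of a real number to `[-r, r]`. -/
def truncate (r v : ℝ) : ℝ := max (-r) (min v r)

theorem abs_truncate_le {r : ℝ} (hr : 0 ≤ r) (v : ℝ) : |truncate r v| ≤ r := by
  unfold truncate
  exact abs_le.2 ⟨le_max_left _ _, max_le (by linarith) (min_le_right _ _)⟩

theorem abs_truncate_sub_le (r r' v v' : ℝ) :
    |truncate r v - truncate r' v'| ≤ |v - v'| + |r - r'| := by
  unfold truncate
  refine (abs_max_sub_max_le_max _ _ _ _).trans (max_le ?_ ?_)
  · rw [show -r - -r' = -(r - r') by ring, abs_neg]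
    linarith [abs_nonneg (v - v')]
  · refine (abs_min_sub_min_le_max _ _ _ _).trans (max_le ?_ ?_)
    · linarith [abs_nonneg (r - r')]
    · have := abs_nonneg (v - v')
      linarith

/-- The piecewise linear map of the line stretching the `r`-neighbourhood of each even integer
onto the surrounding interval of length two, and collapsing the rest onto the odd integers. -/
def evenStretch (r u : ℝ) : ℝ := 2 * round (u / 2) + truncate r (evenDev u) / r

theorem abs_evenStretch_sub_self_le {r : ℝ} (hr : 0 < r) (u : ℝ) : |evenStretch r u - u| ≤ 2 := by
  have h1 : evenStretch r u - u = truncate r (evenDev u) / r - evenDev u := by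
    unfold evenStretch evenDev; ring
  have h2 : |truncate r (evenDev u) / r| ≤ 1 := by
    rw [abs_div, abs_of_pos hr, div_le_one hr]
    exact abs_truncate_le hr.le _
  rw [h1]
  refine (abs_sub _ _).trans ?_
  linarith [abs_evenDev_le_one u]

theorem abs_truncate_div_sub_le {s r r' : ℝ} (hs : 0 < s) (hr : s ≤ r) (hr' : s ≤ r') (v v' : ℝ) :
    |truncate r v / r - truncate r' v' / r'| ≤ (|v - v'| + 2 * |r - r'|) / s := by
  have hr0 : 0 < r := hs.trans_le hr
  have hr0' : 0 < r' := hs.trans_le hr'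
  have h1 : truncate r v / r - truncate r' v' / r' =
      (truncate r v - truncate r' v') / r + truncate r' v' / r' * ((r' - r) / r) := by
    field_simp; ring
  have h2 : |truncate r' v' / r'| ≤ 1 := by
    rw [abs_div, abs_of_pos hr0', div_le_one hr0']
    exact abs_truncate_le hr0'.le _
  rw [h1]
  refine (abs_add_le _ _).trans ?_
  rw [abs_mul, abs_div _ r, abs_div _ r, abs_of_pos hr0, abs_sub_comm r' r]
  calc |truncate r v - truncate r' v'| / r + |truncate r' v' / r'| * (|r - r'| / r)
      ≤ (|v - v'| + |r - r'|) / s + 1 * (|r - r'| / s) := by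
        gcongr
        exact abs_truncate_sub_le _ _ _ _
    _ = _ := by ring

theorem one_sub_truncate_div_le {s r v : ℝ} (hs : 0 < s) (hr : s ≤ r) (hr1 : r ≤ 1)
    (hv : v ≤ 1) : 1 - truncate r v / r ≤ (1 - v) / s := by
  have hr0 : 0 < r := hs.trans_le hr
  have h1 : (1 - v) / r ≤ (1 - v) / s := by gcongr
  refine le_trans ?_ h1
  rw [le_div_iff₀ hr0, sub_mul, div_mul_cancel₀ _ hr0.ne', one_mul]
  have : min v r ≤ truncate r v := le_max_right _ _
  rcases min_choice v r with h | h <;> rw [h] at this <;> linarith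

theorem one_add_truncate_div_le {s r v : ℝ} (hs : 0 < s) (hr : s ≤ r) (hr1 : r ≤ 1)
    (hv : -1 ≤ v) : 1 + truncate r v / r ≤ (1 + v) / s := by
  have hr0 : 0 < r := hs.trans_le hr
  have h1 : (1 + v) / r ≤ (1 + v) / s := by gcongr; linarith
  refine le_trans ?_ h1
  rw [le_div_iff₀ hr0, add_mul, div_mul_cancel₀ _ hr0.ne', one_mul]
  have : truncate r v ≤ max (-r) v := max_le_max le_rfl (min_le_left _ _)
  rcases max_choice (-r) v with h | h <;> rw [h] at this <;> linarith

theorem abs_evenStretch_sub_le {s r r' : ℝ} (hs : 0 < s) (hr : s ≤ r) (hr' : s ≤ r')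
    (hr1 : r ≤ 1) (hr1' : r' ≤ 1) (u u' : ℝ) :
    |evenStretch r u - evenStretch r' u'| ≤ (|u - u'| + 2 * |r - r'|) / s := by
  wlog hk : round (u / 2) ≤ round (u' / 2) generalizing u u' r r'
  · rw [abs_sub_comm, abs_sub_comm u, abs_sub_comm r]
    exact this hr' hr hr1' hr1 u' u (le_of_not_ge hk)
  have hv := abs_le.1 (abs_evenDev_le_one u)
  have hv' := abs_le.1 (abs_evenDev_le_one u')
  rcases hk.eq_or_lt with hk | hk
  · have h1 : evenStretch r u - evenStretch r' u' =
        truncate r (evenDev u) / r - truncate r' (evenDev u') / r' := by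
      unfold evenStretch; rw [hk]; ring
    have h2 : u - u' = evenDev u - evenDev u' := by unfold evenDev; rw [hk]; ring
    rw [h1, h2]
    exact abs_truncate_div_sub_le hs hr hr' _ _
  · have hk' : (round (u / 2) : ℝ) + 1 ≤ round (u' / 2) := by exact_mod_cast hk
    have h1 := one_sub_truncate_div_le hs hr hr1 hv.2
    have h2 := one_add_truncate_div_le hs hr' hr1' hv'.1
    have h3 : ∀ {r : ℝ}, 0 < r → ∀ v, |truncate r v / r| ≤ 1 := fun {r} hr v => by
      rw [abs_div, abs_of_pos hr, div_le_one hr]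
      exact abs_truncate_le hr.le _
    have h4 := abs_le.1 (h3 (hs.trans_le hr) (evenDev u))
    have h5 := abs_le.1 (h3 (hs.trans_le hr') (evenDev u'))
    have hu : u = 2 * round (u / 2) + evenDev u := by unfold evenDev; ring
    have hu' : u' = 2 * round (u' / 2) + evenDev u' := by unfold evenDev; ring
    have hle : evenStretch r u ≤ evenStretch r' u' := by unfold evenStretch; linarith
    rw [abs_sub_comm, abs_of_nonneg (sub_nonneg.2 hle)]
    have h6 : 2 * (round (u' / 2) : ℝ) - 1 - (2 * round (u / 2) + 1) ≤
        (2 * (round (u' / 2) : ℝ) - 1 - (2 * round (u / 2) + 1)) / s := by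
      rw [le_div_iff₀ hs]
      exact mul_le_of_le_one_right (by linarith) (by linarith)
    have h7 : evenStretch r' u' - evenStretch r u ≤ (u' - u) / s := by
      calc evenStretch r' u' - evenStretch r u
          = (1 + truncate r' (evenDev u') / r') + (1 - truncate r (evenDev u) / r) +
            (2 * (round (u' / 2) : ℝ) - 1 - (2 * round (u / 2) + 1)) := by
            unfold evenStretch; ring
        _ ≤ (1 + evenDev u') / s + (1 - evenDev u) / s +
            (2 * (round (u' / 2) : ℝ) - 1 - (2 * round (u / 2) + 1)) / s := by gcongr
        _ = (u' - u) / s := by unfold evenDev; ring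
    refine h7.trans ?_
    gcongr
    rw [abs_sub_comm]
    have := abs_nonneg (r - r')
    linarith [le_abs_self (u' - u), this]

/-- The sup-distance from `y` to the set of points with at least `m + 1` even integer
coordinates. -/
def skeletonDist {n m : ℕ} (hmn : m < n) (y : Fin n → ℝ) : ℝ :=
  (Finset.univ.powersetCard (m + 1)).inf'
    (Finset.powersetCard_nonempty.2 (by simpa using hmn))
    fun J : Finset (Fin n) => ((J.sup fun i => ‖evenDev (y i)‖₊ : NNReal) : ℝ)

section SkeletonDist

variable {n m : ℕ} (hmn : m < n)

theorem exists_finset_skeletonDist (y : Fin n → ℝ) : ∃ J : Finset (Fin n), J.card = m + 1 ∧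
    (∀ i ∈ J, |evenDev (y i)| ≤ skeletonDist hmn y) ∧
    ∃ j ∈ J, |evenDev (y j)| = skeletonDist hmn y := by
  have hne : ((Finset.univ : Finset (Fin n)).powersetCard (m + 1)).Nonempty :=
    Finset.powersetCard_nonempty.2 (by simpa using hmn)
  obtain ⟨J, hJ, h⟩ := Finset.exists_mem_eq_inf' hne
    (fun J : Finset (Fin n) => ((J.sup fun i => ‖evenDev (y i)‖₊ : NNReal) : ℝ))
  have hcard := (Finset.mem_powersetCard.1 hJ).2
  have hρ : skeletonDist hmn y = ((J.sup fun i => ‖evenDev (y i)‖₊ : NNReal) : ℝ) := h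
  refine ⟨J, hcard, fun i hi => ?_, ?_⟩
  · rw [hρ, ← Real.norm_eq_abs, ← coe_nnnorm, NNReal.coe_le_coe]
    exact Finset.le_sup (f := fun i => ‖evenDev (y i)‖₊) hi
  · obtain ⟨j, hj, hje⟩ := Finset.exists_mem_eq_sup J
      (Finset.card_pos.1 (by omega)) (fun i => ‖evenDev (y i)‖₊)
    exact ⟨j, hj, by rw [hρ, hje]; rfl⟩

theorem skeletonDist_le {y : Fin n → ℝ} {J : Finset (Fin n)} (hJ : J.card = m + 1) {s : ℝ}
    (h : ∀ i ∈ J, |evenDev (y i)| ≤ s) : skeletonDist hmn y ≤ s := by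
  have h0 : 0 ≤ s := by
    obtain ⟨i, hi⟩ := Finset.card_pos.1 (by omega : 0 < J.card)
    exact (abs_nonneg _).trans (h i hi)
  refine (Finset.inf'_le _ (Finset.mem_powersetCard.2 ⟨Finset.subset_univ J, hJ⟩)).trans ?_
  lift s to NNReal using h0
  rw [NNReal.coe_le_coe]
  refine Finset.sup_le fun i hi => ?_
  rw [← NNReal.coe_le_coe, coe_nnnorm, Real.norm_eq_abs]
  exact h i hi

theorem skeletonDist_le_one (y : Fin n → ℝ) : skeletonDist hmn y ≤ 1 := by
  obtain ⟨J, hJ, -, j, -, h⟩ := exists_finset_skeletonDist hmn y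
  exact h ▸ abs_evenDev_le_one _

theorem lipschitzWith_skeletonDist : LipschitzWith 1 (skeletonDist hmn) := by
  refine LipschitzWith.of_le_add fun y y' => ?_
  obtain ⟨J, hJ, h, -⟩ := exists_finset_skeletonDist hmn y'
  refine skeletonDist_le hmn hJ fun i hi => (abs_evenDev_le_add (y i) (y' i)).trans ?_
  gcongr
  · exact h i hi
  · rw [← Real.dist_eq]
    exact dist_le_pi_dist y _ _

/-- The retraction, away from the `c`-neighbourhood of the dual skeleton, onto the `m`-skeleton
of the grid of cubes centred at the points with even coordinates. -/
def skeletonRetract (c : ℝ) (y : Fin n → ℝ) : Fin n → ℝ := fun i =>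
  evenStretch (max (skeletonDist hmn y) c) (y i)

theorem dist_skeletonRetract_self_le {c : ℝ} (hc : 0 < c) (y : Fin n → ℝ) :
    dist (skeletonRetract hmn c y) y ≤ 2 := by
  refine (dist_pi_le_iff zero_le_two).2 fun i => ?_
  rw [Real.dist_eq]
  exact abs_evenStretch_sub_self_le (lt_max_of_lt_right hc) _

theorem dist_skeletonRetract_le {c s : ℝ} (hs : 0 < s) (hc1 : c ≤ 1) {y y' : Fin n → ℝ}
    (hy : s ≤ max (skeletonDist hmn y) c) (hy' : s ≤ max (skeletonDist hmn y') c) :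
    dist (skeletonRetract hmn c y) (skeletonRetract hmn c y') ≤ 3 / s * dist y y' := by
  refine (dist_pi_le_iff (by positivity)).2 fun i => ?_
  rw [Real.dist_eq]
  refine (abs_evenStretch_sub_le hs hy hy' (max_le (skeletonDist_le_one hmn _) hc1)
    (max_le (skeletonDist_le_one hmn _) hc1) _ _).trans ?_
  have h1 : |y i - y' i| ≤ dist y y' := by
    rw [← Real.dist_eq]
    exact dist_le_pi_dist y y' i
  have h2 : |max (skeletonDist hmn y) c - max (skeletonDist hmn y') c| ≤ dist y y' := by
    refine (abs_max_sub_max_le_abs _ _ _).trans ?_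
    have := (lipschitzWith_skeletonDist hmn).dist_le_mul y y'
    rwa [NNReal.coe_one, one_mul, Real.dist_eq] at this
  calc _ ≤ (dist y y' + 2 * dist y y') / s := by gcongr
    _ = _ := by ring

end SkeletonDist

theorem truncate_div {r : ℝ} (hr : 0 < r) (v : ℝ) : truncate r v / r = truncate 1 (v / r) := by
  unfold truncate
  rw [← max_div_div_right hr.le, ← min_div_div_right hr.le, neg_div, div_self hr.ne']

theorem truncate_div_eq_of_le_abs {r v : ℝ} (hr : 0 < r) (hv : r ≤ |v|) :
    truncate r v / r = if 0 < v then 1 else -1 := by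
  rw [div_eq_iff hr.ne']
  unfold truncate
  split_ifs with h
  · rw [abs_of_pos h] at hv
    rw [min_eq_right hv, max_eq_right (by linarith), one_mul]
  · rw [abs_of_nonpos (not_lt.1 h)] at hv
    rw [min_eq_left (by linarith), max_eq_left (by linarith), neg_one_mul]

/-- A Lipschitz parametrization of a face of the grid of cubes. -/
def faceChart {n m : ℕ} (σ : Fin m → Fin n) (e : Fin n → ℤ) (ε : ℤ) (p : Fin m → ℝ) :
    Fin n → ℝ := fun i => e i + Function.extend σ (fun a => truncate 1 (ε * p a)) 0 i

theorem lipschitzWith_faceChart {n m : ℕ} {σ : Fin m → Fin n} (hσ : Function.Injective σ)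
    (e : Fin n → ℤ) (ε : ℤ) : LipschitzWith ‖(ε : ℝ)‖₊ (faceChart σ e ε) := by
  refine LipschitzWith.of_dist_le_mul fun p p' => (dist_pi_le_iff (by positivity)).2 fun i => ?_
  simp only [faceChart, dist_add_left]
  by_cases h : ∃ a, σ a = i
  · obtain ⟨a, rfl⟩ := h
    rw [hσ.extend_apply, hσ.extend_apply, Real.dist_eq]
    refine (abs_truncate_sub_le _ _ _ _).trans ?_
    rw [sub_self, abs_zero, add_zero, ← mul_sub, abs_mul, coe_nnnorm, Real.norm_eq_abs,
      ← Real.dist_eq]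
    gcongr
    exact dist_le_pi_dist p p' a
  · rw [Function.extend_apply' _ _ _ h, Function.extend_apply' _ _ _ h, dist_self]
    positivity

theorem exists_skeletonRetract_eq_faceChart {n m : ℕ} (hmn : m < n) {c : ℝ} (hc : 0 < c)
    {y : Fin n → ℝ} (hy : c ≤ skeletonDist hmn y) :
    ∃ (k : Fin n → ℤ) (σ : Fin m → Fin n) (j : Fin n) (e : Fin n → ℤ) (ε : ℤ),
      Function.Injective σ ∧ j ∉ range σ ∧ y j - 2 * k j ≠ 0 ∧
      skeletonRetract hmn c y =
        faceChart σ e ε fun a => (y (σ a) - 2 * k (σ a)) / (y j - 2 * k j) := by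
  set ρ := skeletonDist hmn y with hρ
  have hρ0 : 0 < ρ := hc.trans_le hy
  obtain ⟨J₀, -, -, j, -, hj⟩ := exists_finset_skeletonDist hmn y
  rw [← hρ] at hj
  set I : Finset (Fin n) := Finset.univ.filter fun i => |evenDev (y i)| < ρ with hI
  have hIcard : I.card ≤ m := by
    by_contra hcon
    obtain ⟨J, hJI, hJ⟩ := Finset.exists_subset_card_eq (show m + 1 ≤ I.card by omega)
    obtain ⟨i, hi, hmax⟩ := Finset.exists_max_image J (fun i => |evenDev (y i)|)
      (Finset.card_pos.1 (by omega))
    exact absurd (skeletonDist_le hmn hJ hmax) (not_le.2 (Finset.mem_filter.1 (hJI hi)).2)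
  have hIsub : I ⊆ Finset.univ.erase j := by
    intro i hi
    refine Finset.mem_erase.2 ⟨?_, Finset.mem_univ _⟩
    rintro rfl
    exact absurd (Finset.mem_filter.1 hi).2 (not_lt.2 hj.ge)
  obtain ⟨J, hIJ, hJj, hJ⟩ := Finset.exists_subsuperset_card_eq hIsub hIcard
    (by
      rw [Finset.card_erase_of_mem (Finset.mem_univ _), Finset.card_univ, Fintype.card_fin]
      omega)
  have hjJ : j ∉ J := fun h => (Finset.mem_erase.1 (hJj h)).1 rfl
  set σ : Fin m → Fin n := fun a => J.orderEmbOfFin hJ a with hσ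
  have hrange : range σ = J := Finset.range_orderEmbOfFin J hJ
  have hσinj : Function.Injective σ := (J.orderEmbOfFin hJ).injective
  have hvj : evenDev (y j) ≠ 0 := fun h => by rw [h, abs_zero] at hj; exact hρ0.ne hj
  refine ⟨fun i => round (y i / 2), σ, j,
    fun i => 2 * round (y i / 2) + if i ∈ J then 0 else if 0 < evenDev (y i) then 1 else -1,
    if 0 < evenDev (y j) then 1 else -1, hσinj, by rw [hrange]; exact_mod_cast hjJ, hvj, ?_⟩
  ext i
  simp only [skeletonRetract, faceChart, evenStretch, max_eq_left hy, ← hρ]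
  by_cases hi : i ∈ J
  · obtain ⟨a, rfl⟩ : i ∈ range σ := by rw [hrange]; exact_mod_cast hi
    rw [hσinj.extend_apply, truncate_div hρ0, if_pos hi]
    push_cast
    rw [add_zero]
    congr 2
    change _ = _ * (evenDev (y (σ a)) / evenDev (y j))
    split_ifs with h
    · rw [abs_of_pos h] at hj
      rw [hj, one_mul]
    · rw [abs_of_nonpos (not_lt.1 h)] at hj
      rw [← hj]
      field_simp
  · rw [Function.extend_apply', if_neg hi, truncate_div_eq_of_le_abs hρ0]
    · push_cast
      simp
    · by_contra hlt
      exact hi (hIJ (Finset.mem_filter.2 ⟨Finset.mem_univ _, not_le.1 hlt⟩))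
    · rintro ⟨a, rfl⟩
      exact hi (by rw [← Finset.mem_coe, ← hrange]; exact mem_range_self a)

theorem ae_hausdorffMeasure_skeletonRetract_image {N n m : ℕ} (hmn : m < n)
    {A : Set (Fin N → ℝ)} (hAc : IsCompact A) (hfin : μH[m] A ≠ ⊤) (hA : NoLipschitzPiece m A)
    {k₀ : Fin N} (hone : ∀ x ∈ A, x k₀ = 1) {c : ℝ} (hc : 0 < c) :
    ∀ᵐ P : Fin N → Fin n → ℝ, μH[m] ((fun x => skeletonRetract hmn c (colMap P x)) ''
      {x ∈ A | c ≤ skeletonDist hmn (colMap P x)}) = 0 := by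
  filter_upwards [ae_forall_volume_shifted_centralProj (n := n) hAc hfin hA hone] with P hP
  let D (k : Fin n → ℤ) (σ : Fin m → Fin n) (j : Fin n) : Set (Fin m → ℝ) :=
    (fun x i => (colMap P x (σ i) - 2 * k (σ i)) / (colMap P x j - 2 * k j)) ''
      {x ∈ A | colMap P x j - 2 * k j ≠ 0}
  have hsub : (fun x => skeletonRetract hmn c (colMap P x)) ''
      {x ∈ A | c ≤ skeletonDist hmn (colMap P x)} ⊆
      ⋃ (k : Fin n → ℤ) (σ : Fin m → Fin n) (j : Fin n) (e : Fin n → ℤ) (ε : ℤ)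
        (_ : Function.Injective σ) (_ : j ∉ range σ), faceChart σ e ε '' D k σ j := by
    rintro _ ⟨x, ⟨hx, hxc⟩, rfl⟩
    obtain ⟨k, σ, j, e, ε, hσ, hj, hne, h⟩ := exists_skeletonRetract_eq_faceChart hmn hc hxc
    simp only [mem_iUnion]
    exact ⟨k, σ, j, e, ε, hσ, hj, _, ⟨x, ⟨hx, hne⟩, rfl⟩, h.symm⟩
  refine measure_mono_null hsub ?_
  simp only [measure_iUnion_null_iff]
  intro k σ j e ε hσ hj
  refine le_antisymm (((lipschitzWith_faceChart hσ e ε).hausdorffMeasure_image_le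
    (by positivity) _).trans ?_) bot_le
  rw [← volume_eq_hausdorffMeasure_fin, hP k σ hσ j hj, mul_zero]

theorem volume_setOf_abs_evenDev_add_le (u s : ℝ) :
    volume {τ : ℝ | |τ| ≤ 1 ∧ |evenDev (u + τ)| ≤ s} ≤ 8 * ENNReal.ofReal s := by
  set k := round (u / 2) with hk
  have hsub : {τ : ℝ | |τ| ≤ 1 ∧ |evenDev (u + τ)| ≤ s} ⊆
      closedBall (2 * (k - 1) - u) s ∪ (closedBall (2 * k - u) s ∪
        closedBall (2 * (k + 1) - u) s) := by
    rintro τ ⟨h1, h2⟩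
    have hu := abs_le.1 (abs_evenDev_le_one u)
    have ht := abs_le.1 (abs_evenDev_le_one (u + τ))
    have h1' := abs_le.1 h1
    simp only [evenDev, ← hk] at hu ht h2
    set k' := round ((u + τ) / 2) with hk'
    have hlo : ((k - 2 : ℤ) : ℝ) < k' := by push_cast; linarith
    have hhi : (k' : ℝ) < ((k + 2 : ℤ) : ℝ) := by push_cast; linarith
    have hlo' : k - 2 < k' := by exact_mod_cast hlo
    have hhi' : k' < k + 2 := by exact_mod_cast hhi
    simp only [mem_union, mem_closedBall, Real.dist_eq]
    have hcases : k' = k - 1 ∨ k' = k ∨ k' = k + 1 := by omega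
    rcases hcases with h | h | h <;> rw [h] at h2 <;> push_cast at h2
    · left; convert h2 using 2; ring
    · right; left; convert h2 using 2; ring
    · right; right; convert h2 using 2; ring
  refine (measure_mono hsub).trans ((measure_union_le _ _).trans
    ((add_le_add le_rfl (measure_union_le _ _)).trans ?_))
  rw [Real.volume_closedBall, Real.volume_closedBall, Real.volume_closedBall,
    ENNReal.ofReal_mul zero_le_two, ENNReal.ofReal_ofNat, ← two_mul, ← mul_assoc, ← add_mul]
  gcongr
  norm_num

theorem volume_setOf_skeletonDist_add_le {n m : ℕ} (hmn : m < n) (y : Fin n → ℝ) (s : ℝ) :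
    volume {t | t ∈ closedBall (0 : Fin n → ℝ) 1 ∧ skeletonDist hmn (y + t) ≤ s} ≤
      16 ^ n * ENNReal.ofReal s ^ (m + 1) := by
  let Q (J : Finset (Fin n)) (i : Fin n) : Set ℝ :=
    if i ∈ J then {τ : ℝ | |τ| ≤ 1 ∧ |evenDev (y i + τ)| ≤ s} else Icc (-1) 1
  have hsub : {t | t ∈ closedBall (0 : Fin n → ℝ) 1 ∧ skeletonDist hmn (y + t) ≤ s} ⊆
      ⋃ J ∈ Finset.univ.powersetCard (m + 1), univ.pi (Q J) := by
    rintro t ⟨ht, hs⟩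
    obtain ⟨J, hJ, h, -⟩ := exists_finset_skeletonDist hmn (y + t)
    have hti : ∀ i, |t i| ≤ 1 := fun i => by
      have := (dist_le_pi_dist t 0 i).trans ht
      simpa [Real.dist_eq] using this
    refine mem_iUnion₂.2 ⟨J, Finset.mem_powersetCard.2 ⟨Finset.subset_univ _, hJ⟩, ?_⟩
    intro i _
    simp only [Q]
    split_ifs with hi
    · exact ⟨hti i, (h i hi).trans hs⟩
    · exact abs_le.1 (hti i)
  have hpi : ∀ J ∈ Finset.univ.powersetCard (m + 1), volume (univ.pi (Q J)) ≤
      8 ^ n * ENNReal.ofReal s ^ (m + 1) := by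
    intro J hJ
    rw [volume_pi_pi]
    calc ∏ i, volume (Q J i) ≤ ∏ i, 8 * (if i ∈ J then ENNReal.ofReal s else 1) := by
          refine Finset.prod_le_prod' fun i _ => ?_
          simp only [Q]
          split_ifs
          · exact volume_setOf_abs_evenDev_add_le _ _
          · rw [Real.volume_Icc]
            norm_num
      _ = 8 ^ n * ENNReal.ofReal s ^ (m + 1) := by
          rw [Finset.prod_mul_distrib, Finset.prod_const, Finset.card_univ, Fintype.card_fin,
            Finset.prod_ite_mem, Finset.univ_inter, Finset.prod_const,
            (Finset.mem_powersetCard.1 hJ).2]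
  refine (measure_mono hsub).trans ((measure_biUnion_finset_le _ _).trans
    ((Finset.sum_le_sum hpi).trans ?_))
  rw [Finset.sum_const, Finset.card_powersetCard, Finset.card_univ, Fintype.card_fin, nsmul_eq_mul,
    ← mul_assoc]
  gcongr
  rw [show (16 : ℝ≥0∞) ^ n = 2 ^ n * 8 ^ n by rw [← mul_pow]; norm_num]
  gcongr
  exact_mod_cast Nat.choose_le_two_pow n (m + 1)

section Translates

variable {n m : ℕ} (hmn : m < n) {X : Type*} [MeasurableSpace X] (τ : Measure X)
  [IsFiniteMeasure τ] {γ : X → Fin n → ℝ}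

theorem measurableSet_setOf_skeletonDist_add_le (hγ : Measurable γ) (s : ℝ) :
    MeasurableSet {q : (Fin n → ℝ) × X | skeletonDist hmn (γ q.2 + q.1) ≤ s} := by
  refine measurableSet_le ?_ measurable_const
  exact (lipschitzWith_skeletonDist hmn).continuous.measurable.comp (by fun_prop)

theorem measurable_measure_setOf_skeletonDist_add_le (hγ : Measurable γ) (s : ℝ) :
    Measurable fun t => τ {x | skeletonDist hmn (γ x + t) ≤ s} :=
  measurable_measure_prodMk_left (measurableSet_setOf_skeletonDist_add_le hmn hγ s)

theorem lintegral_measure_setOf_skeletonDist_add_le (hγ : Measurable γ) (s : ℝ) :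
    ∫⁻ t in closedBall (0 : Fin n → ℝ) 1, τ {x | skeletonDist hmn (γ x + t) ≤ s} ≤
      16 ^ n * ENNReal.ofReal s ^ (m + 1) * τ univ := by
  have hm := measurableSet_setOf_skeletonDist_add_le hmn hγ s
  have h1 := Measure.prod_apply (μ := volume.restrict (closedBall (0 : Fin n → ℝ) 1)) (ν := τ) hm
  have h2 := Measure.prod_apply_symm (μ := volume.restrict (closedBall (0 : Fin n → ℝ) 1))
    (ν := τ) hm
  have h3 : ∫⁻ t in closedBall (0 : Fin n → ℝ) 1, τ {x | skeletonDist hmn (γ x + t) ≤ s} = _ :=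
    h1.symm.trans h2
  rw [h3, ← lintegral_const]
  refine lintegral_mono fun x => ?_
  rw [Measure.restrict_apply (hm.preimage measurable_prodMk_right)]
  refine (measure_mono ?_).trans (volume_setOf_skeletonDist_add_le hmn (γ x) s)
  rintro t ⟨ht1, ht2⟩
  exact ⟨ht2, ht1⟩

end Translates

theorem exists_leftInverse_colMap {n : ℕ} {G : Fin n → Fin n → ℝ} {δ : ℝ} (hδ : 0 < δ)
    (hG : ∀ x, ‖colMap G x - δ⁻¹ • x‖ ≤ δ⁻¹ / 2 * ‖x‖) :
    ∃ T : (Fin n → ℝ) →ₗ[ℝ] (Fin n → ℝ), (∀ x, T (colMap G x) = x) ∧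
      ∀ y, ‖T y‖ ≤ 2 * δ * ‖y‖ := by
  let Gl : (Fin n → ℝ) →ₗ[ℝ] (Fin n → ℝ) :=
    { toFun := colMap G
      map_add' := fun x y => by simp [colMap, add_smul, Finset.sum_add_distrib]
      map_smul' := fun c x => colMap_smul G c x }
  have hlow : ∀ x, ‖x‖ ≤ 2 * δ * ‖Gl x‖ := by
    intro x
    have h1 : ‖δ⁻¹ • x‖ ≤ ‖colMap G x‖ + δ⁻¹ / 2 * ‖x‖ := by
      calc ‖δ⁻¹ • x‖ = ‖colMap G x - (colMap G x - δ⁻¹ • x)‖ := by congr 1; abel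
        _ ≤ _ := (norm_sub_le _ _).trans (by gcongr; exact hG x)
    rw [norm_smul, Real.norm_of_nonneg (by positivity)] at h1
    have h2 : δ⁻¹ / 2 * ‖x‖ ≤ ‖colMap G x‖ := by linarith
    calc ‖x‖ = 2 * δ * (δ⁻¹ / 2 * ‖x‖) := by field_simp
      _ ≤ _ := by gcongr; exact h2
  have hinj : Function.Injective Gl := by
    rw [injective_iff_map_eq_zero]
    intro x hx
    have := hlow x
    rw [hx, norm_zero, mul_zero] at this
    exact norm_le_zero_iff.1 this
  let e := LinearEquiv.ofInjectiveEndo Gl hinj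
  have he : ∀ x, e x = Gl x := fun x => rfl
  refine ⟨e.symm.toLinearMap, fun x => e.symm_apply_apply x, fun y => ?_⟩
  have := hlow (e.symm y)
  rwa [← he, e.apply_symm_apply] at this

/-- The grid deformation, in the coordinates given by `g` (with inverse linear part `T`), cut off
by the function `χ`. -/
def gridDeform {n m : ℕ} (hmn : m < n) (c : ℝ) (χ : (Fin n → ℝ) → ℝ)
    (T : (Fin n → ℝ) →ₗ[ℝ] (Fin n → ℝ)) (g : (Fin n → ℝ) → Fin n → ℝ) (x : Fin n → ℝ) :
    Fin n → ℝ :=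
  x + χ x • T (skeletonRetract hmn c (g x) - g x)

section GridDeform

variable {n m : ℕ} {hmn : m < n} {c δ : ℝ} {χ : (Fin n → ℝ) → ℝ}
  {T : (Fin n → ℝ) →ₗ[ℝ] (Fin n → ℝ)} {g : (Fin n → ℝ) → Fin n → ℝ}

theorem norm_linear_skeletonRetract_sub_le (hc : 0 < c) (hδ : 0 < δ)
    (hT : ∀ y, ‖T y‖ ≤ 2 * δ * ‖y‖) (y : Fin n → ℝ) :
    ‖T (skeletonRetract hmn c y - y)‖ ≤ 4 * δ := by
  refine (hT _).trans ?_
  have := dist_skeletonRetract_self_le hmn hc y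
  rw [dist_eq_norm] at this
  calc 2 * δ * ‖skeletonRetract hmn c y - y‖ ≤ 2 * δ * 2 := by gcongr
    _ = _ := by ring

theorem dist_gridDeform_self_le (hc : 0 < c) (hδ : 0 < δ) (hT : ∀ y, ‖T y‖ ≤ 2 * δ * ‖y‖)
    (hχ : ∀ x, |χ x| ≤ 1) (x : Fin n → ℝ) : dist (gridDeform hmn c χ T g x) x ≤ 4 * δ := by
  rw [gridDeform, dist_self_add_left, norm_smul, Real.norm_eq_abs]
  refine (mul_le_of_le_one_left (norm_nonneg _) (hχ x)).trans ?_
  exact norm_linear_skeletonRetract_sub_le hc hδ hT _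

theorem dist_gridDeform_le (hc : 0 < c) (hc1 : c ≤ 1) (hδ : 0 < δ)
    (hT : ∀ y, ‖T y‖ ≤ 2 * δ * ‖y‖) (hχ : ∀ x, |χ x| ≤ 1)
    (hχL : ∀ x x', |χ x - χ x'| ≤ δ⁻¹ * dist x x')
    (hg : ∀ x x', dist (g x) (g x') ≤ 3 / 2 * δ⁻¹ * dist x x') {s : ℝ} (hs : 0 < s) (hs1 : s ≤ 1)
    {x x' : Fin n → ℝ} (hx : s ≤ max (skeletonDist hmn (g x)) c)
    (hx' : s ≤ max (skeletonDist hmn (g x')) c) :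
    dist (gridDeform hmn c χ T g x) (gridDeform hmn c χ T g x') ≤ 17 / s * dist x x' := by
  set F := skeletonRetract hmn c with hF
  have hw : ‖T (F (g x) - g x) - T (F (g x') - g x')‖ ≤ (9 / s + 3) * dist x x' := by
    rw [← map_sub]
    refine (hT _).trans ?_
    have h1 : ‖F (g x) - g x - (F (g x') - g x')‖ ≤
        3 / s * dist (g x) (g x') + dist (g x) (g x') := by
      rw [sub_sub_sub_comm]
      refine (norm_sub_le _ _).trans ?_
      rw [← dist_eq_norm, ← dist_eq_norm]
      gcongr
      exact dist_skeletonRetract_le hmn hs hc1 hx hx'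
    calc _ ≤ 2 * δ * (3 / s * (3 / 2 * δ⁻¹ * dist x x') + 3 / 2 * δ⁻¹ * dist x x') := by
          refine mul_le_mul_of_nonneg_left (h1.trans ?_) (by positivity)
          gcongr <;> exact hg x x'
      _ = _ := by field_simp; ring
  have hw' : ‖T (F (g x') - g x')‖ ≤ 4 * δ := norm_linear_skeletonRetract_sub_le hc hδ hT _
  have hsplit : gridDeform hmn c χ T g x - gridDeform hmn c χ T g x' =
      (x - x') + (χ x • (T (F (g x) - g x) - T (F (g x') - g x')) +
        (χ x - χ x') • T (F (g x') - g x')) := by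
    simp only [gridDeform, ← hF]
    rw [smul_sub, sub_smul]
    abel
  rw [dist_eq_norm, hsplit]
  refine (norm_add_le _ _).trans ((add_le_add le_rfl (norm_add_le _ _)).trans ?_)
  rw [norm_smul, norm_smul, Real.norm_eq_abs, Real.norm_eq_abs, ← dist_eq_norm x x']
  have h8 : (8 : ℝ) ≤ 8 / s := by rw [le_div_iff₀ hs]; linarith
  calc dist x x' + (|χ x| * ‖T (F (g x) - g x) - T (F (g x') - g x')‖ +
        |χ x - χ x'| * ‖T (F (g x') - g x')‖)
      ≤ dist x x' + (1 * ((9 / s + 3) * dist x x') + δ⁻¹ * dist x x' * (4 * δ)) := by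
        gcongr
        · exact hχ x
        · exact hχL x x'
    _ = (9 / s + 8) * dist x x' := by field_simp; ring
    _ ≤ (9 / s + 8 / s) * dist x x' := by gcongr
    _ = 17 / s * dist x x' := by ring

end GridDeform

theorem exists_dyadic_layer {ρ : ℝ} (hρ : ρ ≤ 1) (l₀ : ℕ) :
    ρ ≤ (1 / 2) ^ l₀ ∨ ∃ l < l₀, (1 / 2) ^ (l + 1) ≤ ρ ∧ ρ ≤ (1 / 2) ^ l := by
  induction l₀ with
  | zero => left; simpa using hρ
  | succ k ih =>
    rcases ih with h | ⟨l, hl, h⟩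
    · rcases le_total ρ ((1 / 2) ^ (k + 1)) with h' | h'
      · exact .inl h'
      · exact .inr ⟨k, k.lt_succ_self, h', h⟩
    · exact .inr ⟨l, hl.trans k.lt_succ_self, h⟩

section LayerEstimate

variable {n m : ℕ} {f : (Fin n → ℝ) → Fin n → ℝ} {ρ : (Fin n → ℝ) → ℝ} {C : ℝ} {l₀ : ℕ}

theorem hausdorffMeasure_image_le_of_dyadic (hC : 0 ≤ C)
    {s : ℝ} (hs : 0 < s) {W : Set (Fin n → ℝ)}
    (hf : ∀ x ∈ W, ∀ x' ∈ W, dist (f x) (f x') ≤ C / s * dist x x') :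
    μH[m] (f '' W) ≤ ENNReal.ofReal (C / s) ^ m * μH[m] W := by
  have hL : LipschitzOnWith (Real.toNNReal (C / s)) f W := by
    refine LipschitzOnWith.of_dist_le_mul fun x hx y hy => ?_
    rw [Real.coe_toNNReal _ (by positivity)]
    exact hf x hx y hy
  refine (hL.hausdorffMeasure_image_le (Nat.cast_nonneg m)).trans (le_of_eq ?_)
  rw [ENNReal.rpow_natCast]
  rfl

theorem hausdorffMeasure_image_le_sum_layers (hC : 0 ≤ C) (hρ1 : ∀ x, ρ x ≤ 1)
    (hf : ∀ s, 0 < s → s ≤ 1 → ∀ x x', s ≤ max (ρ x) ((1 / 2) ^ l₀) →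
      s ≤ max (ρ x') ((1 / 2) ^ l₀) → dist (f x) (f x') ≤ C / s * dist x x')
    (W : Set (Fin n → ℝ)) :
    μH[m] (f '' W) ≤ ∑ l ∈ Finset.range l₀, ENNReal.ofReal (2 * C * 2 ^ l) ^ m *
        μH[m] ({x | ρ x ≤ (1 / 2) ^ l} ∩ W) +
      ENNReal.ofReal (2 * C * 2 ^ l₀) ^ m * μH[m] ({x | ρ x ≤ (1 / 2) ^ l₀} ∩ W) := by
  have hcov : W ⊆ (⋃ l ∈ Finset.range l₀,
      {x | (1 / 2) ^ (l + 1) ≤ ρ x ∧ ρ x ≤ (1 / 2) ^ l} ∩ W) ∪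
      ({x | ρ x ≤ (1 / 2) ^ l₀} ∩ W) := by
    intro x hx
    rcases exists_dyadic_layer (hρ1 x) l₀ with h | ⟨l, hl, h⟩
    · exact .inr ⟨h, hx⟩
    · exact .inl (mem_iUnion₂.2 ⟨l, Finset.mem_range.2 hl, h, hx⟩)
  refine (measure_mono (image_mono hcov)).trans ?_
  rw [image_union, image_iUnion₂]
  refine (measure_union_le _ _).trans (add_le_add ((measure_biUnion_finset_le _ _).trans
    (Finset.sum_le_sum fun l hl => ?_)) ?_)
  · refine (hausdorffMeasure_image_le_of_dyadic hC (s := (1 / 2) ^ (l + 1)) (by positivity)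
      fun x hx x' hx' => hf _ (by positivity) (pow_le_one₀ (by norm_num) (by norm_num)) x x'
        (le_max_of_le_left hx.1.1) (le_max_of_le_left hx'.1.1)).trans ?_
    gcongr ?_ * ?_
    · gcongr
      apply le_of_eq
      rw [one_div, inv_pow, div_inv_eq_mul]
      ring
    · exact measure_mono fun x hx => ⟨hx.1.2, hx.2⟩
  · refine (hausdorffMeasure_image_le_of_dyadic hC (s := (1 / 2) ^ l₀) (by positivity)
      fun x hx x' hx' => hf _ (by positivity) (pow_le_one₀ (by norm_num) (by norm_num)) x x'
        (le_max_right _ _) (le_max_right _ _)).trans ?_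
    gcongr
    rw [one_div, inv_pow, div_inv_eq_mul]
    gcongr
    linarith

theorem hausdorffMeasure_image_le_of_null (hC : 0 ≤ C)
    (hf : ∀ s, 0 < s → s ≤ 1 → ∀ x x', s ≤ max (ρ x) ((1 / 2) ^ l₀) →
      s ≤ max (ρ x') ((1 / 2) ^ l₀) → dist (f x) (f x') ≤ C / s * dist x x')
    {K : Set (Fin n → ℝ)} (hK : μH[m] (f '' {x ∈ K | (1 / 2) ^ l₀ ≤ ρ x}) = 0) :
    μH[m] (f '' K) ≤
      ENNReal.ofReal (2 * C * 2 ^ l₀) ^ m * μH[m] ({x | ρ x ≤ (1 / 2) ^ l₀} ∩ K) := by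
  have hcov : K ⊆ {x ∈ K | (1 / 2) ^ l₀ ≤ ρ x} ∪ ({x | ρ x ≤ (1 / 2) ^ l₀} ∩ K) := by
    intro x hx
    rcases le_total ((1 / 2) ^ l₀) (ρ x) with h | h
    · exact .inl ⟨hx, h⟩
    · exact .inr ⟨h, hx⟩
  refine (measure_mono (image_mono hcov)).trans ?_
  rw [image_union]
  refine (measure_union_le _ _).trans ?_
  rw [hK, zero_add]
  refine (hausdorffMeasure_image_le_of_dyadic hC (s := (1 / 2) ^ l₀) (by positivity)
      fun x hx x' hx' => hf _ (by positivity) (pow_le_one₀ (by norm_num) (by norm_num)) x x'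
        (le_max_right _ _) (le_max_right _ _)).trans ?_
  gcongr
  rw [one_div, inv_pow, div_inv_eq_mul]
  gcongr
  linarith

end LayerEstimate

/-- The bound for the measure of the image of a set under a grid deformation, as a function of the
translation of the grid. -/
def layerSum {n m : ℕ} (hmn : m < n) {X : Type*} [MeasurableSpace X] (τ τ' : Measure X)
    (γ : X → Fin n → ℝ) (C : ℝ) (l₀ : ℕ) (t : Fin n → ℝ) : ℝ≥0∞ :=
  ∑ l ∈ Finset.range l₀, ENNReal.ofReal (C * 2 ^ l) ^ m *
      τ {x | skeletonDist hmn (γ x + t) ≤ (1 / 2) ^ l} +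
    ENNReal.ofReal (C * 2 ^ l₀) ^ m * τ {x | skeletonDist hmn (γ x + t) ≤ (1 / 2) ^ l₀} +
    ENNReal.ofReal (C * 2 ^ l₀) ^ m * τ' {x | skeletonDist hmn (γ x + t) ≤ (1 / 2) ^ l₀}

theorem ofReal_mul_two_pow_mul (m l : ℕ) {C : ℝ} (hC : 0 ≤ C) :
    ENNReal.ofReal (C * 2 ^ l) ^ m * ENNReal.ofReal ((1 / 2) ^ l) ^ (m + 1) =
      ENNReal.ofReal C ^ m * ENNReal.ofReal ((1 / 2) ^ l) := by
  have h : ENNReal.ofReal (2 ^ l) * ENNReal.ofReal ((1 / 2) ^ l) = 1 := by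
    rw [← ENNReal.ofReal_mul (by positivity), ← mul_pow]
    norm_num
  rw [ENNReal.ofReal_mul hC]
  calc _ = ENNReal.ofReal C ^ m * (ENNReal.ofReal (2 ^ l) * ENNReal.ofReal ((1 / 2) ^ l)) ^ m *
        ENNReal.ofReal ((1 / 2) ^ l) := by ring
    _ = _ := by rw [h, one_pow, mul_one]

theorem sum_ofReal_half_pow_le (l₀ : ℕ) :
    ∑ l ∈ Finset.range l₀, ENNReal.ofReal ((1 / 2) ^ l) ≤ 2 := by
  rw [← ENNReal.ofReal_sum_of_nonneg fun _ _ => by positivity]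
  rw [show (2 : ℝ≥0∞) = ENNReal.ofReal 2 by simp]
  refine ENNReal.ofReal_le_ofReal ?_
  exact (Summable.sum_le_tsum _ (fun _ _ => by positivity) summable_geometric_two).trans
    tsum_geometric_two.le

section LayerSum

variable {n m : ℕ} (hmn : m < n) {X : Type*} [MeasurableSpace X] (τ τ' : Measure X)
  [IsFiniteMeasure τ] [IsFiniteMeasure τ'] {γ : X → Fin n → ℝ}

theorem measurable_layerSum (hγ : Measurable γ) (C : ℝ) (l₀ : ℕ) :
    Measurable (layerSum hmn τ τ' γ C l₀) := by
  have h := fun s => measurable_measure_setOf_skeletonDist_add_le hmn τ hγ s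
  have h' := fun s => measurable_measure_setOf_skeletonDist_add_le hmn τ' hγ s
  exact ((Finset.measurable_sum _ fun l _ => (h _).const_mul _).add ((h _).const_mul _)).add
    ((h' _).const_mul _)

theorem lintegral_layerSum_le (hγ : Measurable γ) {C : ℝ} (hC : 0 ≤ C) (l₀ : ℕ) :
    ∫⁻ t in closedBall (0 : Fin n → ℝ) 1, layerSum hmn τ τ' γ C l₀ t ≤
      3 * 16 ^ n * ENNReal.ofReal C ^ m *
        (τ univ + ENNReal.ofReal ((1 / 2) ^ l₀) * τ' univ) := by
  have h := fun s => measurable_measure_setOf_skeletonDist_add_le hmn τ hγ s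
  have h' := fun s => measurable_measure_setOf_skeletonDist_add_le hmn τ' hγ s
  have hterm : ∀ (σ : Measure X) [IsFiniteMeasure σ] (l : ℕ),
      ∫⁻ t in closedBall (0 : Fin n → ℝ) 1, ENNReal.ofReal (C * 2 ^ l) ^ m *
        σ {x | skeletonDist hmn (γ x + t) ≤ (1 / 2) ^ l} ≤
      16 ^ n * ENNReal.ofReal C ^ m * σ univ * ENNReal.ofReal ((1 / 2) ^ l) := by
    intro σ _ l
    rw [lintegral_const_mul _ (measurable_measure_setOf_skeletonDist_add_le hmn σ hγ _)]
    calc _ ≤ ENNReal.ofReal (C * 2 ^ l) ^ m *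
          (16 ^ n * ENNReal.ofReal ((1 / 2) ^ l) ^ (m + 1) * σ univ) := by
          gcongr
          exact lintegral_measure_setOf_skeletonDist_add_le hmn σ hγ _
      _ = 16 ^ n * σ univ * (ENNReal.ofReal (C * 2 ^ l) ^ m *
          ENNReal.ofReal ((1 / 2) ^ l) ^ (m + 1)) := by ring
      _ = _ := by rw [ofReal_mul_two_pow_mul m l hC]; ring
  have hhalf : ENNReal.ofReal ((1 / 2) ^ l₀) ≤ 1 :=
    ENNReal.ofReal_le_one.2 (pow_le_one₀ (by norm_num) (by norm_num))
  unfold layerSum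
  rw [lintegral_add_right _ ((h' _).const_mul _), lintegral_add_right _ ((h _).const_mul _),
    lintegral_finsetSum _ fun l _ => (h _).const_mul _]
  set Q := (16 : ℝ≥0∞) ^ n * ENNReal.ofReal C ^ m with hQ
  calc _ ≤ ∑ l ∈ Finset.range l₀, Q * τ univ * ENNReal.ofReal ((1 / 2) ^ l) +
        Q * τ univ * ENNReal.ofReal ((1 / 2) ^ l₀) +
        Q * τ' univ * ENNReal.ofReal ((1 / 2) ^ l₀) := by
        gcongr with l
        · exact hterm τ l
        · exact hterm τ l₀
        · exact hterm τ' l₀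
    _ ≤ Q * τ univ * 2 + Q * τ univ * 1 + 3 * (Q * τ' univ * ENNReal.ofReal ((1 / 2) ^ l₀)) := by
        rw [← Finset.mul_sum]
        refine add_le_add (add_le_add ?_ ?_) ?_
        · gcongr
          exact sum_ofReal_half_pow_le l₀
        · gcongr
        · exact le_mul_of_one_le_left' (by norm_num)
    _ = _ := by rw [hQ]; ring

end LayerSum

theorem exists_notMem_null_le_lintegral_closedBall {n : ℕ} {f : (Fin n → ℝ) → ℝ≥0∞}
    (hf : Measurable f) {B : Set (Fin n → ℝ)} (hB : volume B = 0) :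
    ∃ t ∉ B, f t ≤ ∫⁻ t in closedBall (0 : Fin n → ℝ) 1, f t := by
  have hvol : volume (closedBall (0 : Fin n → ℝ) 1) = 2 ^ n := by
    rw [volume_closedBall_fin]
    · simp
    all_goals norm_num
  have h1 : 1 ≤ volume.restrict (closedBall (0 : Fin n → ℝ) 1) univ := by
    rw [Measure.restrict_apply_univ, hvol]
    exact one_le_pow₀ (by norm_num)
  have hne : volume.restrict (closedBall (0 : Fin n → ℝ) 1) ≠ 0 := by
    intro h
    rw [h] at h1
    simp at h1
  have : IsFiniteMeasure (volume.restrict (closedBall (0 : Fin n → ℝ) 1)) :=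
    ⟨by rw [Measure.restrict_apply_univ, hvol]; finiteness⟩
  obtain ⟨t, ht, hle⟩ := exists_notMem_null_le_laverage hne hf.aemeasurable
    (le_antisymm ((Measure.restrict_apply_le _ _).trans hB.le) bot_le)
  refine ⟨t, ht, hle.trans ?_⟩
  rw [laverage_eq]
  exact ENNReal.div_le_of_le_mul (le_mul_of_one_le_right' h1)

theorem colMap_cons_one {n k : ℕ} (P : Fin (n + 1) → Fin k → ℝ) (x : Fin n → ℝ) :
    colMap P (Fin.cons 1 x) = P 0 + colMap (fun i => P i.succ) x := by
  simp [colMap, Fin.sum_univ_succ]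

theorem dist_cons_one {n : ℕ} (x y : Fin n → ℝ) :
    dist (Fin.cons 1 x : Fin (n + 1) → ℝ) (Fin.cons 1 y) = dist x y := by
  refine le_antisymm ((dist_pi_le_iff dist_nonneg).2 fun i => ?_)
    ((dist_pi_le_iff dist_nonneg).2 fun i => ?_)
  · refine Fin.cases ?_ (fun i => ?_) i
    · simp
    · simpa using dist_le_pi_dist x y i
  · simpa using dist_le_pi_dist (Fin.cons 1 x : Fin (n + 1) → ℝ) (Fin.cons 1 y) i.succ

theorem isometry_cons_one {n : ℕ} :
    Isometry (fun x : Fin n → ℝ => (Fin.cons 1 x : Fin (n + 1) → ℝ)) :=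
  Isometry.of_dist_eq dist_cons_one

theorem NoLipschitzPiece.image_cons_one {n m : ℕ} {K : Set (Fin n → ℝ)}
    (hK : NoLipschitzPiece m K) :
    NoLipschitzPiece m ((fun x : Fin n → ℝ => (Fin.cons 1 x : Fin (n + 1) → ℝ)) '' K) := by
  have htail : LipschitzWith 1 fun y : Fin (n + 1) → ℝ => (fun i => y i.succ : Fin n → ℝ) := by
    refine LipschitzWith.of_dist_le_mul fun y y' => ?_
    rw [NNReal.coe_one, one_mul]
    exact (dist_pi_le_iff dist_nonneg).2 fun i => dist_le_pi_dist y y' i.succ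
  refine hK.of_lipschitzOnWith htail.lipschitzOnWith
    (isometry_cons_one.lipschitz.lipschitzOnWith (s := _)) ?_ ?_
  · rintro _ ⟨x, hx, rfl⟩
    simpa using hx
  · rintro _ ⟨x, hx, rfl⟩
    simp

/-- Almost every small perturbation of a scaling is in general position. -/
theorem exists_near_scaling_of_ae {n : ℕ} {p : (Fin (n + 1) → Fin n → ℝ) → Prop}
    (hp : ∀ᵐ P, p P) {δ : ℝ} (hδ : 0 < δ) :
    ∃ P, p P ∧ ∀ x, ‖colMap (fun i => P i.succ) x - δ⁻¹ • x‖ ≤ δ⁻¹ / 2 * ‖x‖ := by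
  let P₀ : Fin (n + 1) → Fin n → ℝ := Fin.cons 0 fun i => Pi.single i δ⁻¹
  obtain ⟨P, hPball, hPp⟩ := (Measure.dense_of_ae hp).exists_mem_open
    (isOpen_ball (x := P₀) (ε := δ⁻¹ / 2 / (n + 1))) ⟨P₀, mem_ball_self (by positivity)⟩
  refine ⟨P, hPball, fun x => ?_⟩
  have hid : δ⁻¹ • x = colMap (fun i => P₀ i.succ) x := by
    ext i
    simp [colMap_apply, P₀, Pi.single_apply, mul_comm]
  have hsub : colMap (fun i => P i.succ) x - δ⁻¹ • x =
      ∑ k, x k • (P k.succ - P₀ k.succ) := by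
    rw [hid]
    simp [colMap, smul_sub]
  rw [hsub]
  calc ‖∑ k, x k • (P k.succ - P₀ k.succ)‖ ≤ ∑ k : Fin n, ‖x‖ * (δ⁻¹ / 2 / (n + 1)) := by
        refine (norm_sum_le _ _).trans (Finset.sum_le_sum fun k _ => ?_)
        rw [norm_smul]
        gcongr
        · exact norm_le_pi_norm x k
        · rw [← dist_eq_norm]
          exact (dist_le_pi_dist P P₀ k.succ).trans (mem_ball.1 hPp).le
    _ = δ⁻¹ / 2 * ‖x‖ * (n / (n + 1)) := by
        rw [Finset.sum_const, Finset.card_univ, Fintype.card_fin, nsmul_eq_mul]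
        ring
    _ ≤ δ⁻¹ / 2 * ‖x‖ := by
        refine mul_le_of_le_one_right (by positivity) ?_
        rw [div_le_one (by positivity)]
        linarith

/-- A compact set `K` without Lipschitz pieces can be deformed near itself by a small Lipschitz map
onto a set of small `Hᵐ` measure, with controlled increase of the measure of a further set `S`. -/
theorem exists_deformation_hausdorffMeasure_image_le {n m : ℕ} (hmn : m < n)
    {K S V : Set (Fin n → ℝ)} (hKc : IsCompact K) (hKfin : μH[m] K ≠ ⊤)
    (hK : NoLipschitzPiece m K) (hSfin : μH[m] S ≠ ⊤) (hV : IsOpen V) (hKV : K ⊆ V) (l₀ : ℕ)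
    {η : ℝ} (hη : 0 < η) :
    ∃ ψ : (Fin n → ℝ) → Fin n → ℝ, (∃ L : NNReal, LipschitzWith L ψ) ∧
      (∀ x, dist (ψ x) x ≤ η) ∧ (∀ x ∉ V, ψ x = x) ∧
      μH[m] (ψ '' (S ∪ K)) ≤ 3 * 16 ^ n * ENNReal.ofReal (2 * 17) ^ m *
        (μH[m] S + ENNReal.ofReal ((1 / 2) ^ l₀) * μH[m] K) := by
  obtain ⟨δ₀, hδ₀, hthick⟩ := hKc.exists_thickening_subset_open hV hKV
  set δ := min δ₀ (η / 4) with hδdef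
  have hδ : 0 < δ := lt_min hδ₀ (by positivity)
  set c : ℝ := (1 / 2) ^ l₀ with hcdef
  have hc : 0 < c := by positivity
  have hc1 : c ≤ 1 := pow_le_one₀ (by norm_num) (by norm_num)
  set χ : (Fin n → ℝ) → ℝ := fun x => (thickenedIndicator hδ₀ K x : ℝ) with hχdef
  have hχ : ∀ x, |χ x| ≤ 1 := fun x => by
    rw [abs_of_nonneg (NNReal.coe_nonneg _)]
    exact_mod_cast thickenedIndicator_le_one hδ₀ K x
  have hχL : ∀ x x', |χ x - χ x'| ≤ δ⁻¹ * dist x x' := fun x x' => by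
    have h := (lipschitzWith_thickenedIndicator hδ₀ K).dist_le_mul x x'
    rw [NNReal.dist_eq] at h
    refine h.trans ?_
    gcongr
    rw [NNReal.coe_inv, Real.coe_toNNReal _ hδ₀.le]
    exact inv_anti₀ hδ (min_le_left _ _)
  -- general position
  have hAc : IsCompact ((fun x : Fin n → ℝ => (Fin.cons 1 x : Fin (n + 1) → ℝ)) '' K) :=
    hKc.image isometry_cons_one.continuous
  have hAfin : μH[m] ((fun x : Fin n → ℝ => (Fin.cons 1 x : Fin (n + 1) → ℝ)) '' K) ≠ ⊤ := by
    rwa [isometry_cons_one.hausdorffMeasure_image (.inl (Nat.cast_nonneg m))]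
  have hae := ae_hausdorffMeasure_skeletonRetract_image hmn hAc hAfin hK.image_cons_one
    (k₀ := 0) (by rintro _ ⟨x, -, rfl⟩; simp) hc
  obtain ⟨P, hP, hPG⟩ := exists_near_scaling_of_ae (ae_ae_add_notMem_of_measure_eq_zero
    (ν := (volume : Measure (Fin n → ℝ))) (B := fun t => Pi.single 0 t)
    (continuous_single 0).measurable (ae_iff.1 hae)) hδ
  set G : Fin n → Fin n → ℝ := fun i => P i.succ with hG
  obtain ⟨T, hTG, hT⟩ := exists_leftInverse_colMap hδ hPG
  have hGup : ∀ x, ‖colMap G x‖ ≤ 3 / 2 * δ⁻¹ * ‖x‖ := fun x => by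
    have h := norm_le_norm_add_norm_sub' (colMap G x) (δ⁻¹ • x)
    rw [norm_smul, Real.norm_of_nonneg (by positivity)] at h
    linarith [hPG x]
  -- choice of the translation
  have hτ : IsFiniteMeasure (μH[m].restrict S) := ⟨by simpa using hSfin.lt_top⟩
  have hτ' : IsFiniteMeasure (μH[m].restrict K) := ⟨by simpa using hKfin.lt_top⟩
  set γ : (Fin n → ℝ) → Fin n → ℝ := fun x => P 0 + colMap G x with hγdef
  have hγ : Measurable γ := (continuous_const.add (continuous_colMap_right G)).measurable
  obtain ⟨t, ht, hle⟩ := exists_notMem_null_le_lintegral_closedBall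
    (measurable_layerSum hmn (μH[m].restrict S) (μH[m].restrict K) hγ (2 * 17) l₀) (ae_iff.1 hP)
  replace hle := hle.trans (lintegral_layerSum_le hmn (μH[m].restrict S) (μH[m].restrict K) hγ
    (by norm_num) l₀)
  set g : (Fin n → ℝ) → Fin n → ℝ := fun x => γ x + t with hgdef
  have hg : ∀ x x', dist (g x) (g x') ≤ 3 / 2 * δ⁻¹ * dist x x' := fun x x' => by
    rw [hgdef]
    simp only [hγdef, dist_add_right, dist_add_left]
    rw [dist_eq_norm, ← colMap_sub, dist_eq_norm]
    exact hGup _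
  have hgP : ∀ x, colMap (P + Pi.single 0 t) (Fin.cons 1 x) = g x := fun x => by
    rw [colMap_add_single, colMap_cons_one]
    simp [hgdef, hγdef, hG]
  set ψ := gridDeform hmn c χ T g with hψ
  have hlip : ∀ s, 0 < s → s ≤ 1 → ∀ x x', s ≤ max (skeletonDist hmn (g x)) c →
      s ≤ max (skeletonDist hmn (g x')) c → dist (ψ x) (ψ x') ≤ 17 / s * dist x x' :=
    fun s hs hs1 x x' hx hx' => dist_gridDeform_le hc hc1 hδ hT hχ hχL hg hs hs1 hx hx'
  have hnull : μH[m] (ψ '' {x ∈ K | c ≤ skeletonDist hmn (g x)}) = 0 := by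
    have hbad := not_not.1 (not_not.1 ht)
    have hTL : LipschitzWith (Real.toNNReal (2 * δ)) fun z => T (z - (P 0 + t)) := by
      refine LipschitzWith.of_dist_le_mul fun z z' => ?_
      rw [Real.coe_toNNReal _ (by positivity), dist_eq_norm, ← map_sub, sub_sub_sub_cancel_right,
        dist_eq_norm]
      exact hT _
    refine measure_mono_null ?_ (le_antisymm ((hTL.hausdorffMeasure_image_le
      (Nat.cast_nonneg m) _).trans (by rw [hbad, mul_zero])) bot_le)
    rintro _ ⟨x, ⟨hxK, hxc⟩, rfl⟩
    refine ⟨_, ⟨Fin.cons 1 x, ⟨⟨x, hxK, rfl⟩, by rwa [hgP]⟩, rfl⟩, ?_⟩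
    have hχ1 : χ x = 1 := by
      simp only [hχdef, thickenedIndicator_one hδ₀ K hxK, NNReal.coe_one]
    simp only [hψ, gridDeform, hχ1, one_smul, hgP]
    have : skeletonRetract hmn c (g x) - g x =
        skeletonRetract hmn c (g x) - (P 0 + t) - colMap G x := by
      simp only [hgdef, hγdef]; abel
    rw [this, map_sub T (skeletonRetract hmn c (g x) - (P 0 + t)) (colMap G x), hTG]
    abel
  refine ⟨ψ, ⟨Real.toNNReal (17 / c), LipschitzWith.of_dist_le_mul fun x x' => ?_⟩,
    fun x => ?_, fun x hx => ?_, ?_⟩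
  · rw [Real.coe_toNNReal _ (by positivity)]
    exact hlip c hc hc1 x x' (le_max_right _ _) (le_max_right _ _)
  · refine (dist_gridDeform_self_le hc hδ hT hχ x).trans ?_
    have : δ ≤ η / 4 := min_le_right _ _
    linarith
  · have : χ x = 0 := by
      simp only [hχdef, thickenedIndicator_zero hδ₀ K fun h => hx (hthick h), NNReal.coe_zero]
    simp only [hψ, gridDeform, this, zero_smul, add_zero]
  · rw [image_union]
    refine (measure_union_le _ _).trans (le_trans ?_ (hle.trans_eq (by
      rw [Measure.restrict_apply_univ, Measure.restrict_apply_univ])))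
    have hmeas : ∀ s : ℝ, MeasurableSet {x | skeletonDist hmn (γ x + t) ≤ s} := fun s =>
      measurableSet_le ((lipschitzWith_skeletonDist hmn).continuous.measurable.comp
        (hγ.add_const t)) measurable_const
    simp only [layerSum, Measure.restrict_apply (hmeas _)]
    exact add_le_add (hausdorffMeasure_image_le_sum_layers (by norm_num)
      (fun x => skeletonDist_le_one hmn (g x)) hlip S)
      (hausdorffMeasure_image_le_of_null (by norm_num) hlip hnull)

/-- **Exhaustion.** A family of measurable sets has a countable subfamily whose union contains
every member up to a null set. -/
theorem exists_seq_forall_measure_diff_iUnion_eq_zero {X : Type*} [MeasurableSpace X]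
    (ν : Measure X) [IsFiniteMeasure ν] {𝓕 : Set (Set X)} (hne : 𝓕.Nonempty)
    (hmeas : ∀ A ∈ 𝓕, MeasurableSet A) :
    ∃ u : ℕ → Set X, (∀ i, u i ∈ 𝓕) ∧ ∀ A ∈ 𝓕, ν (A \ ⋃ i, u i) = 0 := by
  obtain ⟨A₀, hA₀⟩ := hne
  have : Nonempty {u : ℕ → Set X // ∀ i, u i ∈ 𝓕} := ⟨⟨fun _ => A₀, fun _ => hA₀⟩⟩
  obtain ⟨v, -, hv, hv_mem⟩ := exists_seq_tendsto_sSup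
    (range_nonempty fun u : {u : ℕ → Set X // ∀ i, u i ∈ 𝓕} => ν (⋃ i, u.1 i))
    (OrderTop.bddAbove _)
  choose w hw using hv_mem
  set u : ℕ → Set X := fun i => (w i.unpair.1).1 i.unpair.2 with hu
  have hu_mem : ∀ i, u i ∈ 𝓕 := fun i => (w _).2 _
  refine ⟨u, hu_mem, fun A hA => ?_⟩
  have hsup : sSup (range fun u : {u : ℕ → Set X // ∀ i, u i ∈ 𝓕} => ν (⋃ i, u.1 i)) ≤
      ν (⋃ i, u i) := le_of_tendsto' hv fun k => by
    rw [← hw k]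
    refine measure_mono (iUnion_subset fun j => ?_)
    exact subset_iUnion_of_subset (Nat.pair k j) (by simp [hu])
  have hle : ν (A ∪ ⋃ i, u i) ≤ ν (⋃ i, u i) := by
    refine le_trans ?_ hsup
    refine le_trans (measure_mono ?_) (le_sSup ⟨⟨fun i => Nat.casesOn i A u, fun i => ?_⟩, rfl⟩)
    · refine union_subset (subset_iUnion_of_subset 0 subset_rfl) (iUnion_subset fun i => ?_)
      exact subset_iUnion_of_subset (i + 1) subset_rfl
    · cases i with
      | zero => exact hA
      | succ i => exact hu_mem i
  have hU : MeasurableSet (⋃ i, u i) := .iUnion fun i => hmeas _ (hu_mem i)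
  rw [← sdiff_union_self, measure_union disjoint_sdiff_left hU] at hle
  exact nonpos_iff_eq_zero.1 ((ENNReal.add_le_add_iff_right (measure_ne_top ν _)).1
    (hle.trans_eq (zero_add _).symm))

/-- The range of a Lipschitz map between Euclidean spaces is Borel. -/
theorem LipschitzWith.measurableSet_range {n m : ℕ} {f : En m → En n} {L : NNReal}
    (hf : LipschitzWith L f) : MeasurableSet (range f) := by
  obtain ⟨k, hk, hU⟩ := isSigmaCompact_range hf.continuous
  rw [← hU]
  exact .iUnion fun i => (hk i).measurableSet

/-- Every subset of `ℝⁿ` is `m`-rectifiable when `n ≤ m`. -/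
theorem lt_of_not_isRectifiable {n m : ℕ} {E : Set (En n)} (hE : ¬ IsRectifiable n m E) :
    m < n := by
  by_contra! h
  have hlip : LipschitzWith 1 fun (x : Fin m → ℝ) (i : Fin n) => x (Fin.castLE h i) :=
    LipschitzWith.of_dist_le_mul fun x y => by
      rw [NNReal.coe_one, one_mul]
      exact (dist_pi_le_iff dist_nonneg).2 fun i => dist_le_pi_dist x y _
  refine hE ⟨fun _ x => WithLp.toLp 2 fun i => x (Fin.castLE h i), fun _ => ⟨_,
    (PiLp.lipschitzWith_toLp 2 fun _ : Fin n => ℝ).comp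
      (hlip.comp (PiLp.lipschitzWith_ofLp 2 fun _ : Fin m => ℝ))⟩, ?_⟩
  · refine measure_mono_null (sdiff_eq_empty.2 fun y _ => ?_).subset measure_empty
    refine mem_iUnion.2 ⟨0, WithLp.toLp 2 fun j =>
      if hj : j.1 < n then y ⟨j, hj⟩ else 0, ?_⟩
    ext i
    simp

/-- A nonrectifiable set of finite measure contains a compact set of positive measure without
Lipschitz pieces. -/
theorem exists_isCompact_noLipschitzPiece {n m : ℕ} {E : Set (En n)} (hE : MeasurableSet E)
    (hfin : μH[m] E < ⊤) (hnot : ¬ IsRectifiable n m E) :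
    ∃ K ⊆ E, IsCompact K ∧ 0 < μH[m] K ∧ NoLipschitzPiece m (WithLp.ofLp '' K) := by
  have : IsFiniteMeasure (μH[m].restrict E) := ⟨by simpa using hfin⟩
  obtain ⟨u, hu, hmax⟩ := exists_seq_forall_measure_diff_iUnion_eq_zero (μH[m].restrict E)
    (𝓕 := {A | ∃ f : En m → En n, (∃ L : NNReal, LipschitzWith L f) ∧ range f = A})
    ⟨_, fun _ => 0, ⟨0, .const 0⟩, rfl⟩
    (by rintro _ ⟨f, ⟨L, hf⟩, rfl⟩; exact hf.measurableSet_range)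
  have hu_meas : MeasurableSet (⋃ i, u i) := .iUnion fun i => by
    obtain ⟨f, ⟨L, hf⟩, hfu⟩ := hu i
    exact hfu ▸ hf.measurableSet_range
  choose f hf hfu using hu
  have hpos : 0 < μH[m].restrict E (E \ ⋃ i, u i) := by
    rw [Measure.restrict_apply' hE, inter_eq_left.2 sdiff_subset]
    refine pos_iff_ne_zero.2 fun h => hnot ⟨f, hf, ?_⟩
    simpa only [hfu] using h
  obtain ⟨K, hKE, hKc, hK⟩ := (hE.diff hu_meas).exists_lt_isCompact hpos
  rw [Measure.restrict_apply' hE, inter_eq_left.2 (hKE.trans sdiff_subset)] at hK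
  refine ⟨K, hKE.trans sdiff_subset, hKc, hK, fun S g C hg hgK => ?_⟩
  obtain ⟨G, hG, hgG⟩ := hg.extend_pi
  have hGnull := hmax _ ⟨fun x => WithLp.toLp 2 (G x.ofLp), ⟨_,
    (PiLp.lipschitzWith_toLp 2 fun _ : Fin n => ℝ).comp
      (hG.comp (PiLp.lipschitzWith_ofLp 2 fun _ : Fin m => ℝ))⟩, rfl⟩
  rw [Measure.restrict_apply' hE] at hGnull
  have h := (PiLp.lipschitzWith_ofLp 2 fun _ : Fin n => ℝ).hausdorffMeasure_image_le
    (Nat.cast_nonneg m) ((range (fun x : En m => WithLp.toLp 2 (G x.ofLp)) \ ⋃ i, u i) ∩ E)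
  rw [hGnull, mul_zero] at h
  refine measure_mono_null ?_ (nonpos_iff_eq_zero.1 h)
  rintro _ ⟨x, hx, rfl⟩
  obtain ⟨y, hy, hyx⟩ := hgK (mem_image_of_mem g hx)
  refine ⟨y, ⟨⟨⟨WithLp.toLp 2 x, ?_⟩, (hKE hy).2⟩, (hKE hy).1⟩, hyx⟩
  simp only [← hgG hx, ← hyx]

/-- The Euclidean form of `exists_deformation_hausdorffMeasure_image_le`. -/
theorem exists_lipschitz_hausdorffMeasure_image_le {n m : ℕ} (hmn : m < n) :
    ∃ C : ℝ≥0∞, C ≠ ⊤ ∧ ∀ {K S V : Set (En n)}, IsCompact K → μH[m] K ≠ ⊤ →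
      NoLipschitzPiece m (WithLp.ofLp '' K) → μH[m] S ≠ ⊤ → IsOpen V → K ⊆ V → ∀ (l : ℕ) {η : ℝ},
      0 < η → ∃ ψ : En n → En n, (∃ L : NNReal, LipschitzWith L ψ) ∧ (∀ x, dist (ψ x) x ≤ η) ∧
        (∀ x ∉ V, ψ x = x) ∧
        μH[m] (ψ '' (S ∪ K)) ≤ C * (μH[m] S + ENNReal.ofReal ((1 / 2) ^ l) * μH[m] K) := by
  have hto := PiLp.lipschitzWith_toLp 2 fun _ : Fin n => ℝ
  have hof := PiLp.lipschitzWith_ofLp 2 fun _ : Fin n => ℝ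
  set D : NNReal := (Fintype.card (Fin n) : NNReal) ^ (1 / 2 : ℝ≥0∞).toReal
  have hofle : ∀ A : Set (En n), μH[m] (WithLp.ofLp '' A) ≤ μH[m] A := fun A => by
    simpa using hof.hausdorffMeasure_image_le (Nat.cast_nonneg m) A
  refine ⟨(D : ℝ≥0∞) ^ (m : ℝ) * (3 * 16 ^ n * ENNReal.ofReal (2 * 17) ^ m), by finiteness,
    fun {K S V} hKc hKfin hK hSfin hV hKV l {η} hη => ?_⟩
  have hD : 0 < (D : ℝ) + 1 := by positivity
  obtain ⟨ψ, ⟨L, hL⟩, hdist, hoff, hle⟩ := exists_deformation_hausdorffMeasure_image_le hmn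
    (hKc.image hof.continuous) ((hofle K).trans_lt hKfin.lt_top).ne hK
    ((hofle S).trans_lt hSfin.lt_top).ne (hV.preimage hto.continuous)
    (image_subset_iff.2 fun x hx => hKV hx) l (div_pos hη hD)
  refine ⟨fun x => WithLp.toLp 2 (ψ x.ofLp), ⟨_, hto.comp (hL.comp hof)⟩, fun x => ?_,
    fun x hx => ?_, ?_⟩
  · calc _ ≤ D * dist (ψ x.ofLp) x.ofLp := hto.dist_le_mul _ _
      _ ≤ (D + 1) * (η / (D + 1)) := by
        gcongr
        · linarith
        · exact hdist _
      _ = η := by field_simp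
  · exact congrArg (WithLp.toLp 2) (hoff _ hx)
  · have himage : (fun x : En n => WithLp.toLp 2 (ψ x.ofLp)) '' (S ∪ K) =
        WithLp.toLp 2 '' (ψ '' (WithLp.ofLp '' S ∪ WithLp.ofLp '' K)) := by
      rw [← image_union, image_image, image_image]
    rw [himage, mul_assoc]
    refine (hto.hausdorffMeasure_image_le (Nat.cast_nonneg m) _).trans ?_
    gcongr
    refine hle.trans ?_
    gcongr
    · exact hofle S
    · exact hofle K

theorem stmt3 (n m : ℕ) (E : Set (En n)) (hE : MeasurableSet E)
    (hfin : μH[m] E < ⊤) (hcl : μH[(m : ℝ) + 1] (closure E) = 0)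
    (hnot : ¬ IsRectifiable n m E) :
    ∃ ψ : ℕ → En n → En n,
      (∀ i, ∃ L : NNReal, LipschitzWith L (ψ i)) ∧
      TendstoUniformly ψ id atTop ∧
      Filter.atTop.liminf (fun i => μH[m] (ψ i '' E)) < μH[m] E := by
  have hmn := lt_of_not_isRectifiable hnot
  obtain ⟨K, hKE, hKc, hKpos, hK⟩ := exists_isCompact_noLipschitzPiece hE hfin hnot
  have hKfin : μH[m] K ≠ ⊤ := ((measure_mono hKE).trans_lt hfin).ne
  have : IsFiniteMeasure (μH[m].restrict E) := ⟨by simpa using hfin⟩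
  obtain ⟨C, hC, hdeform⟩ := exists_lipschitz_hausdorffMeasure_image_le hmn
  have hlim : Tendsto (fun l : ℕ => C * (ENNReal.ofReal ((1 / 2) ^ l) +
      ENNReal.ofReal ((1 / 2) ^ l) * μH[m] K)) atTop (nhds 0) := by
    have h : Tendsto (fun l : ℕ => ENNReal.ofReal ((1 / 2) ^ l)) atTop (nhds 0) := by
      simpa using ENNReal.tendsto_ofReal
        (tendsto_pow_atTop_nhds_zero_of_lt_one (r := (1 / 2 : ℝ)) (by norm_num) (by norm_num))
    simpa using ENNReal.Tendsto.const_mul (h.add (ENNReal.Tendsto.mul_const h (.inr hKfin)))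
      (.inr hC)
  obtain ⟨l, hl⟩ := (hlim.eventually_lt_const hKpos).exists
  obtain ⟨V, hKV, hV, -, hVK⟩ := hKc.measurableSet.exists_isOpen_sdiff_lt
    (measure_ne_top (μH[m].restrict E) K)
    (ENNReal.ofReal_pos.2 (by positivity : (0 : ℝ) < (1 / 2) ^ l)).ne'
  rw [Measure.restrict_apply' hE] at hVK
  choose ψ hψL hψdist hψoff hψle using fun i : ℕ => hdeform hKc hKfin hK
    (hVK.trans_le le_top).ne hV hKV l (Nat.one_div_pos_of_nat (α := ℝ) (n := i))
  refine ⟨ψ, hψL, ?_, ?_⟩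
  · refine Metric.tendstoUniformly_iff.2 fun ε hε => ?_
    filter_upwards [tendsto_one_div_add_atTop_nhds_zero_nat.eventually_lt_const hε] with i hi x
    rw [dist_comm]
    exact (hψdist i x).trans_lt hi
  have hbound : ∀ i, μH[m] (ψ i '' E) ≤ μH[m] (E \ V) + C * (ENNReal.ofReal ((1 / 2) ^ l) +
      ENNReal.ofReal ((1 / 2) ^ l) * μH[m] K) := fun i => by
    have hcov : ψ i '' E ⊆ (E \ V) ∪ ψ i '' (((V \ K) ∩ E) ∪ K) := by
      rintro _ ⟨x, hx, rfl⟩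
      by_cases hxV : x ∈ V
      · by_cases hxK : x ∈ K
        · exact .inr ⟨x, .inr hxK, rfl⟩
        · exact .inr ⟨x, .inl ⟨⟨hxV, hxK⟩, hx⟩, rfl⟩
      · exact .inl ((hψoff i x hxV).symm ▸ ⟨hx, hxV⟩)
    refine (measure_mono hcov).trans ((measure_union_le _ _).trans ?_)
    gcongr
    exact (hψle i).trans (by gcongr)
  calc _ ≤ μH[m] (E \ V) + C * (ENNReal.ofReal ((1 / 2) ^ l) +
        ENNReal.ofReal ((1 / 2) ^ l) * μH[m] K) :=
        (liminf_le_liminf (.of_forall hbound)).trans_eq (liminf_const _)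
    _ < μH[m] (E \ V) + μH[m] K := by
        gcongr
        exact ((measure_mono sdiff_subset).trans_lt hfin).ne
    _ = μH[m] ((E \ V) ∪ K) :=
        (measure_union (disjoint_sdiff_left.mono_right hKV) hKc.measurableSet).symm
    _ ≤ μH[m] E := measure_mono (union_subset sdiff_subset hKE)
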